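/- For n ∈ ℤ let Gₙ = ⟨a, b ∣ a wⁿ = wⁿ b⟩ with w = a b⁻¹ a⁻¹ b (the fundamental group of the exterior of the n-twist knot). Suppose p, q, r ≥ 2 are integers with 1/p + 1/q + 1/r < 1 (a hyperbolic triple), let Δ ≤ PSL(2,ℝ) be a discrete subgroup isomorphic to the (p,q,r)-triangle group Δ(p,q,r), and suppose there exists a surjective group homomorphism ρ : Gₙ → Δ such that ρ(a) is an elliptic element of PSL(2,ℝ). Then n = 1 (so the knot is the trefoil), and (p,q,r) is a permutation of (2,3,r') for some integer r' ≥ 7. -/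

import Mathlib

noncomputable section

/-- `SL(2,ℝ)`. -/
abbrev SL2R : Type := Matrix.SpecialLinearGroup (Fin 2) ℝ

/-- `PSL(2,ℝ)`, the quotient of `SL(2,ℝ)` by its center `{±I}`. -/
abbrev PSL2R : Type := SL2R ⧸ Subgroup.center SL2R

/-- The matrix topology on `SL(2,ℝ)`. -/
instance : TopologicalSpace SL2R :=
  TopologicalSpace.induced (fun M => (M : Matrix (Fin 2) (Fin 2) ℝ)) inferInstance

/-- Squared trace, well defined on `PSL(2,ℝ)`. -/
def tr2R (x : PSL2R) : ℝ :=
  (Matrix.trace ((Quotient.out x : SL2R) : Matrix (Fin 2) (Fin 2) ℝ)) ^ 2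

/-- An element `g ∈ PSL(2,ℝ)` is elliptic if `g ≠ 1` and `tr²(g) < 4`. -/
def IsElliptic (g : PSL2R) : Prop := g ≠ 1 ∧ tr2R g < 4

/-- The relator `a wⁿ (wⁿ b)⁻¹` with `w = a b⁻¹ a⁻¹ b`, where `a, b` are the two generators. -/
def twistRel (n : ℤ) : FreeGroup (Fin 2) :=
  FreeGroup.of 0 *
    (FreeGroup.of 0 * (FreeGroup.of 1)⁻¹ * (FreeGroup.of 0)⁻¹ * FreeGroup.of 1) ^ n *
    ((FreeGroup.of 0 * (FreeGroup.of 1)⁻¹ * (FreeGroup.of 0)⁻¹ * FreeGroup.of 1) ^ n *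
      FreeGroup.of 1)⁻¹

/-- The group `Gₙ = ⟨a, b ∣ a wⁿ = wⁿ b⟩`, `w = a b⁻¹ a⁻¹ b`; the fundamental group of the
exterior of the `n`-twist knot. -/
abbrev TwistKnotGroup (n : ℤ) := PresentedGroup ({twistRel n} : Set (FreeGroup (Fin 2)))

/-- The relations of the triangle group `Δ(p,q,r) = ⟨x, y, z ∣ xᵖ = y^q = zʳ = xyz = 1⟩`. -/
def triangleRels3 (p q r : ℕ) : Set (FreeGroup (Fin 3)) :=
  {FreeGroup.of 0 ^ p, FreeGroup.of 1 ^ q, FreeGroup.of 2 ^ r,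
    FreeGroup.of 0 * FreeGroup.of 1 * FreeGroup.of 2}

/-- The `(p,q,r)`-triangle group `Δ(p,q,r) = ⟨x, y, z ∣ xᵖ = y^q = zʳ = xyz = 1⟩`. -/
abbrev TriangleGroup (p q r : ℕ) := PresentedGroup (triangleRels3 p q r)

noncomputable section

/-- A point of the hyperbolic plane, encoded as a matrix `[[a,b],[c,-a]]` of square `-1`. -/
@[ext] structure HPt where
  a : ℝ
  b : ℝ
  c : ℝ
  hc : 0 < c
  h : a * a + b * c = -1

namespace HPt

/-- `cosh` of the distance of two points. -/
def v (P Q : HPt) : ℝ := -(2 * P.a * Q.a + P.b * Q.c + P.c * Q.b) / 2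

/-- The rotation with half-angle `θ` about `P`. -/
def rot (P : HPt) (θ : ℝ) : SL2R :=
  ⟨!![Real.cos θ + Real.sin θ * P.a, Real.sin θ * P.b; Real.sin θ * P.c,
    Real.cos θ - Real.sin θ * P.a], by
    rw [Matrix.det_fin_two_of]
    linear_combination (-(Real.sin θ)^2) * P.h + Real.sin_sq_add_cos_sq θ⟩

lemma det_eq (g : SL2R) : g 0 0 * g 1 1 - g 0 1 * g 1 0 = 1 := by
  have := g.det_coe
  rwa [Matrix.det_fin_two] at this

/-- The action of `SL(2,ℝ)`. -/
def act (g : SL2R) (P : HPt) : HPt where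
  a := (g 0 0 * P.a + g 0 1 * P.c) * g 1 1 - (g 0 0 * P.b - g 0 1 * P.a) * g 1 0
  b := -(g 0 0 * P.a + g 0 1 * P.c) * g 0 1 + (g 0 0 * P.b - g 0 1 * P.a) * g 0 0
  c := (g 1 0 * P.a + g 1 1 * P.c) * g 1 1 - (g 1 0 * P.b - g 1 1 * P.a) * g 1 0
  hc := by
    have h := P.h
    have hc := P.hc
    have hd := det_eq g
    have h1 : P.c * ((g 1 0 * P.a + g 1 1 * P.c) * g 1 1 - (g 1 0 * P.b - g 1 1 * P.a) * g 1 0)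
      = (g 1 1 * P.c + g 1 0 * P.a)^2 + (g 1 0)^2 := by
      linear_combination (-(g 1 0)^2) * h
    have h2 : 0 < (g 1 1 * P.c + g 1 0 * P.a)^2 + (g 1 0)^2 := by
      by_cases h0 : g 1 0 = 0
      · have : g 1 1 ≠ 0 := by
          intro h3; rw [h0, h3] at hd; simp at hd
        rw [h0]; simp; positivity
      · positivity
    rw [← h1] at h2
    exact (pos_iff_pos_of_mul_pos h2).1 hc
  h := by
    linear_combination ((g 0 0 * g 1 1 - g 0 1 * g 1 0)^2) * P.h - (g 0 0 * g 1 1 - g 0 1 * g 1 0 + 1) * det_eq g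

lemma sl_ext {g h : SL2R} (h00 : g 0 0 = h 0 0) (h01 : g 0 1 = h 0 1) (h10 : g 1 0 = h 1 0)
    (h11 : g 1 1 = h 1 1) : g = h := by
  ext i j
  fin_cases i <;> fin_cases j <;> assumption

lemma mul_00 (g h : SL2R) : (g * h) 0 0 = g 0 0 * h 0 0 + g 0 1 * h 1 0 := by
  simp [Matrix.mul_apply, Fin.sum_univ_two]
lemma mul_01 (g h : SL2R) : (g * h) 0 1 = g 0 0 * h 0 1 + g 0 1 * h 1 1 := by
  simp [Matrix.mul_apply, Fin.sum_univ_two]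
lemma mul_10 (g h : SL2R) : (g * h) 1 0 = g 1 0 * h 0 0 + g 1 1 * h 1 0 := by
  simp [Matrix.mul_apply, Fin.sum_univ_two]
lemma mul_11 (g h : SL2R) : (g * h) 1 1 = g 1 0 * h 0 1 + g 1 1 * h 1 1 := by
  simp [Matrix.mul_apply, Fin.sum_univ_two]
lemma inv_00 (g : SL2R) : (g⁻¹) 0 0 = g 1 1 := by
  simp [Matrix.SpecialLinearGroup.coe_inv, Matrix.adjugate_fin_two]
lemma inv_01 (g : SL2R) : (g⁻¹) 0 1 = -g 0 1 := by
  simp [Matrix.SpecialLinearGroup.coe_inv, Matrix.adjugate_fin_two]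
lemma inv_10 (g : SL2R) : (g⁻¹) 1 0 = -g 1 0 := by
  simp [Matrix.SpecialLinearGroup.coe_inv, Matrix.adjugate_fin_two]
lemma inv_11 (g : SL2R) : (g⁻¹) 1 1 = g 0 0 := by
  simp [Matrix.SpecialLinearGroup.coe_inv, Matrix.adjugate_fin_two]

lemma rot_00 (P : HPt) (θ : ℝ) : P.rot θ 0 0 = Real.cos θ + Real.sin θ * P.a := rfl
lemma rot_01 (P : HPt) (θ : ℝ) : P.rot θ 0 1 = Real.sin θ * P.b := rfl
lemma rot_10 (P : HPt) (θ : ℝ) : P.rot θ 1 0 = Real.sin θ * P.c := rfl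
lemma rot_11 (P : HPt) (θ : ℝ) : P.rot θ 1 1 = Real.cos θ - Real.sin θ * P.a := rfl

lemma rot_add (P : HPt) (θ φ : ℝ) : P.rot (θ + φ) = P.rot θ * P.rot φ := by
  have h := P.h
  apply sl_ext <;>
  simp only [mul_00, mul_01, mul_10, mul_11, rot_00, rot_01, rot_10, rot_11,
    Real.sin_add, Real.cos_add]
  · linear_combination (-Real.sin θ * Real.sin φ) * h
  · ring
  · ring
  · linear_combination (-Real.sin θ * Real.sin φ) * h

lemma rot_zero (P : HPt) : P.rot 0 = 1 := by
  apply sl_ext <;> simp [rot_00, rot_01, rot_10, rot_11]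

lemma rot_neg (P : HPt) (θ : ℝ) : P.rot (-θ) = (P.rot θ)⁻¹ := by
  rw [eq_inv_iff_mul_eq_one, ← rot_add]; simp [rot_zero]

lemma rot_nat (P : HPt) (θ : ℝ) (k : ℕ) : P.rot (k * θ) = P.rot θ ^ k := by
  induction k with
  | zero => simp [rot_zero]
  | succ k ih => rw [pow_succ, ← ih, ← rot_add]; congr 1; push_cast; ring

lemma rot_int (P : HPt) (θ : ℝ) (k : ℤ) : P.rot (k * θ) = P.rot θ ^ k := by
  obtain ⟨n, rfl | rfl⟩ := k.eq_nat_or_neg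
  · simpa using rot_nat P θ n
  · have := rot_nat P θ n
    rw [zpow_neg, zpow_natCast, ← this, ← rot_neg]; congr 1; push_cast; ring

lemma conj_rot (g : SL2R) (P : HPt) (θ : ℝ) : g * P.rot θ * g⁻¹ = (act g P).rot θ := by
  have hd := det_eq g
  apply sl_ext <;>
  simp only [mul_00, mul_01, mul_10, mul_11, inv_00, inv_01, inv_10, inv_11, rot_00, rot_01,
    rot_10, rot_11, act]
  · linear_combination Real.cos θ * hd
  · ring
  · ring
  · linear_combination Real.cos θ * hd

lemma v_act (g : SL2R) (P Q : HPt) : v (act g P) (act g Q) = v P Q := by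
  have hd := det_eq g
  simp only [v, act]
  have : v P Q * (g 0 0 * g 1 1 - g 0 1 * g 1 0)^2 = v P Q := by rw [hd]; ring
  simp only [v] at this
  rw [← this]; ring

lemma act_mul (g h : SL2R) (P : HPt) : act (g * h) P = act g (act h P) := by
  ext <;> simp only [mul_00, mul_01, mul_10, mul_11, act] <;> ring

lemma act_one (P : HPt) : act 1 P = P := by
  ext <;> simp [act]

lemma v_comm (P Q : HPt) : v P Q = v Q P := by simp only [v]; ring

lemma v_formula (P Q : HPt) : (v P Q - 1) * (2 * P.c * Q.c) =
    (P.c - Q.c)^2 + (P.a * Q.c - Q.a * P.c)^2 := by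
  simp only [v]
  linear_combination (-Q.c^2) * P.h - P.c^2 * Q.h

lemma one_le_v (P Q : HPt) : 1 ≤ v P Q := by
  have := v_formula P Q
  have h1 := P.hc
  have h2 := Q.hc
  have h3 : 0 ≤ (v P Q - 1) * (2 * P.c * Q.c) := by rw [this]; positivity
  have h4 := nonneg_of_mul_nonneg_left h3 (by positivity)
  linarith

lemma eq_of_v {P Q : HPt} (h : v P Q = 1) : P = Q := by
  have h0 := v_formula P Q
  have h1 := P.hc
  have h2 := Q.hc
  rw [h, sub_self, zero_mul] at h0
  have e1 : P.c = Q.c := by nlinarith [sq_nonneg (P.c - Q.c), sq_nonneg (P.a * Q.c - Q.a * P.c)]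
  have e2 : P.a * Q.c - Q.a * P.c = 0 := by
    nlinarith [sq_nonneg (P.c - Q.c), sq_nonneg (P.a * Q.c - Q.a * P.c)]
  have e3 : P.a = Q.a := by
    rw [e1] at e2
    have : (P.a - Q.a) * Q.c = 0 := by linarith
    rcases mul_eq_zero.1 this with h | h <;> linarith
  have e4 : P.b = Q.b := by
    have hp := P.h
    have hq := Q.h
    rw [e1, e3] at hp
    have : (P.b - Q.b) * Q.c = 0 := by linarith
    rcases mul_eq_zero.1 this with h | h <;> linarith
  exact HPt.ext e3 e4 e1

lemma v_self (P : HPt) : v P P = 1 := by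
  simp only [v]; linear_combination -P.h

lemma one_lt_v {P Q : HPt} (h : P ≠ Q) : 1 < v P Q :=
  lt_of_le_of_ne (one_le_v P Q) (fun h' => h (eq_of_v h'.symm))

lemma v_rot (P Q : HPt) (θ : ℝ) :
    v P (act (Q.rot θ) P) - 1 = 2 * (Real.sin θ)^2 * ((v P Q)^2 - 1) := by
  have hp := P.h
  have hq := Q.h
  have hs := Real.sin_sq_add_cos_sq θ
  simp only [v, act, rot_00, rot_01, rot_10, rot_11]
  linear_combination (-((Real.cos θ)^2 + (Real.sin θ)^2 * (Q.a * Q.a + Q.b * Q.c))) * hp +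
    (Real.sin θ)^2 * hq + hs

/-- The base point. -/
def base : HPt := ⟨0, -1, 1, one_pos, by norm_num⟩

lemma v_base (Q : HPt) : v base Q = (Q.c - Q.b) / 2 := by simp only [v, base]; ring

lemma exists_frame (P : HPt) : ∃ g : SL2R, act g base = P := by
  have hc := P.hc
  obtain ⟨s, hs, hs2⟩ : ∃ s : ℝ, 0 < s ∧ s * s = P.c :=
    ⟨√P.c, Real.sqrt_pos.2 hc, Real.mul_self_sqrt hc.le⟩
  have hs' : s ≠ 0 := hs.ne'
  refine ⟨⟨!![1 / s, P.a / s; 0, s], by rw [Matrix.det_fin_two_of]; field_simp; ring⟩, ?_⟩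
  have hb : P.b = -(1 + P.a^2) / (s * s) := by
    have := P.h
    rw [← hs2] at this
    field_simp
    linarith
  ext
  · simp [act, base]; field_simp
  · simp [act, base, hb]; field_simp
  · simp [act, base, hs2]

lemma v_base_sq (Q : HPt) : (v base Q)^2 = 1 + Q.a^2 + ((Q.b + Q.c)/2)^2 := by
  rw [v_base]; linear_combination -Q.h

lemma exists_polar (x y : ℝ) : ∃ α, x = √(x^2+y^2) * Real.cos α ∧ y = √(x^2+y^2) * Real.sin α := by
  refine ⟨Complex.arg ⟨x, y⟩, ?_, ?_⟩
  · have := Complex.norm_mul_cos_arg ⟨x, y⟩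
    rw [Complex.norm_def, Complex.normSq_mk] at this
    simp only at this
    rw [← sq, ← sq] at this
    exact this.symm
  · have := Complex.norm_mul_sin_arg ⟨x, y⟩
    rw [Complex.norm_def, Complex.normSq_mk] at this
    simp only at this
    rw [← sq, ← sq] at this
    exact this.symm

lemma neighbour_base (N Q : HPt) (m : ℕ) (hm : 1 ≤ m) : ∃ l : ℤ,
    v (act (base.rot (l * (Real.pi / m))) N) Q ≤ v base N * v base Q -
      √((v base N)^2 - 1) * √((v base Q)^2 - 1) * Real.cos (Real.pi / m) := by
  obtain ⟨α, hα1, hα2⟩ := exists_polar N.a ((N.b + N.c)/2)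
  obtain ⟨β, hβ1, hβ2⟩ := exists_polar Q.a ((Q.b + Q.c)/2)
  have hm0 : (0:ℝ) < m := by exact_mod_cast hm
  have eN : N.a^2 + ((N.b + N.c)/2)^2 = (v base N)^2 - 1 := by rw [v_base_sq]; ring
  have eQ : Q.a^2 + ((Q.b + Q.c)/2)^2 = (v base Q)^2 - 1 := by rw [v_base_sq]; ring
  rw [eN] at hα1 hα2
  rw [eQ] at hβ1 hβ2
  set E := √((v base N)^2 - 1)
  set F := √((v base Q)^2 - 1)
  have key : ∀ θ, v (act (base.rot θ) N) Q = v base N * v base Q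
      - E * F * Real.cos (α - β + 2 * θ) := by
    intro θ
    have hs := Real.sin_sq_add_cos_sq θ
    have h1 : E * F * Real.cos (α - β + 2 * θ) =
      (N.a * Q.a + (N.b + N.c)/2 * ((Q.b + Q.c)/2)) * ((Real.cos θ)^2 - (Real.sin θ)^2)
      - ((N.b + N.c)/2 * Q.a - N.a * ((Q.b + Q.c)/2)) * (2 * Real.sin θ * Real.cos θ) := by
      rw [hα1, hα2, hβ1, hβ2, Real.cos_add, Real.cos_two_mul', Real.sin_two_mul, Real.cos_sub,
        Real.sin_sub]
      ring
    rw [h1, v_base, v_base]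
    simp only [v, act, rot_00, rot_01, rot_10, rot_11, base]
    linear_combination ((N.c - N.b) / 2 * ((Q.c - Q.b) / 2)) * hs
  set l : ℤ := -round ((α - β) / (2 * (Real.pi / m))) with hl
  refine ⟨l, ?_⟩
  rw [key]
  have hpm : 0 < Real.pi / m := by positivity
  have hc : Real.cos (Real.pi / m) ≤ Real.cos (α - β + 2 * (l * (Real.pi / m))) := by
    rw [← Real.cos_abs (α - β + _)]
    apply Real.cos_le_cos_of_nonneg_of_le_pi (abs_nonneg _)
    · apply div_le_self Real.pi_pos.le; exact_mod_cast hm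
    · have h1 := abs_sub_round ((α - β) / (2 * (Real.pi / m)))
      have h2 : α - β + 2 * (l * (Real.pi / m)) =
        ((α - β) / (2 * (Real.pi / m)) - round ((α - β) / (2 * (Real.pi / m)))) *
          (2 * (Real.pi / m)) := by
        rw [hl]; push_cast
        rw [sub_mul, div_mul_cancel₀ _ (by positivity)]; ring
      rw [h2, abs_mul, abs_of_pos (show 0 < 2 * (Real.pi / m) by positivity)]
      nlinarith
  have hEF : 0 ≤ E * F := by positivity
  nlinarith

lemma neighbour (P N Q : HPt) (m : ℕ) (hm : 1 ≤ m) : ∃ l : ℤ,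
    v (act (P.rot (l * (Real.pi / m))) N) Q ≤ v P N * v P Q -
      √((v P N)^2 - 1) * √((v P Q)^2 - 1) * Real.cos (Real.pi / m) := by
  obtain ⟨g, rfl⟩ := exists_frame P
  obtain ⟨l, hl⟩ := neighbour_base (act g⁻¹ N) (act g⁻¹ Q) m hm
  refine ⟨l, ?_⟩
  have e : ∀ R, act g (act g⁻¹ R) = R := fun R => by rw [← act_mul, mul_inv_cancel, act_one]
  have e1 : ∀ R, v base (act g⁻¹ R) = v (act g base) R := fun R => by
    rw [← v_act g base, e]
  rw [e1, e1] at hl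
  rw [← conj_rot]
  rw [← v_act g, e, ← act_mul, ← act_mul] at hl
  exact hl

/-- Every elliptic matrix is a rotation. -/
lemma exists_rot (M : SL2R) (h : (M 0 0 + M 1 1)^2 < 4) : ∃ (P : HPt) (θ : ℝ), M = P.rot θ := by
  have hd := det_eq M
  set x := (M 0 0 + M 1 1) / 2 with hx
  have hx1 : 0 < 1 - x^2 := by rw [hx]; nlinarith
  have hc0 : M 1 0 ≠ 0 := by
    intro h0
    rw [h0] at hd
    nlinarith [sq_nonneg (M 0 0 - M 1 1)]
  -- sine with the sign of the lower left entry
  obtain ⟨s, hs2, hsc⟩ : ∃ s : ℝ, s^2 = 1 - x^2 ∧ 0 < M 1 0 / s := by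
    rcases lt_or_gt_of_ne hc0 with h1 | h1
    · refine ⟨-√(1 - x^2), by rw [neg_sq, Real.sq_sqrt hx1.le], ?_⟩
      exact div_pos_of_neg_of_neg h1 (by simpa using hx1)
    · exact ⟨√(1 - x^2), Real.sq_sqrt hx1.le, div_pos h1 (Real.sqrt_pos.2 hx1)⟩
  have hs0 : s ≠ 0 := by rintro rfl; simp at hsc
  obtain ⟨θ, h1, h2⟩ := exists_polar x s
  have e : √(x^2 + s^2) = 1 := by rw [hs2]; simp
  rw [e, one_mul] at h1 h2
  refine ⟨⟨(M 0 0 - M 1 1) / 2 / s, M 0 1 / s, M 1 0 / s, hsc, ?_⟩, θ, ?_⟩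
  · field_simp
    rw [hs2, hx]; linarith
  · apply sl_ext <;> simp only [rot_00, rot_01, rot_10, rot_11, ← h1, ← h2]
    · field_simp; rw [hx]; ring
    · field_simp
    · field_simp
    · field_simp; rw [hx]; ring

lemma mem_center_iff' (M : SL2R) : M ∈ Subgroup.center SL2R ↔ M = 1 ∨ M = -1 := by
  rw [Matrix.SpecialLinearGroup.mem_center_iff]
  constructor
  · rintro ⟨r, hr, h⟩
    simp at hr
    rcases hr with rfl | rfl
    · left; ext i j; rw [← h]; simp [Matrix.one_apply, Matrix.diagonal]
    · right; ext i j; rw [← h]; fin_cases i <;> fin_cases j <;> simp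
  · rintro (rfl | rfl)
    · exact ⟨1, by simp, by simp⟩
    · refine ⟨-1, by simp, ?_⟩
      ext i j; fin_cases i <;> fin_cases j <;> simp

lemma rot_mem_center (P : HPt) (θ : ℝ) :
    P.rot θ ∈ Subgroup.center SL2R ↔ Real.sin θ = 0 := by
  rw [mem_center_iff']
  constructor
  · intro h
    have h1 : P.rot θ 1 0 = 0 := by rcases h with h | h <;> rw [h] <;> simp
    rw [rot_10] at h1
    exact (mul_eq_zero.1 h1).resolve_right P.hc.ne'
  · intro h
    have h1 := Real.sin_sq_add_cos_sq θ
    rw [h] at h1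
    have : Real.cos θ = 1 ∨ Real.cos θ = -1 := by
      exact mul_self_eq_one_iff.1 (by nlinarith)
    rcases this with h2 | h2
    · left; apply sl_ext <;> simp [rot_00, rot_01, rot_10, rot_11, h, h2]
    · right; apply sl_ext <;> simp [rot_00, rot_01, rot_10, rot_11, h, h2]

end HPt
end

noncomputable section
open Filter Topology
namespace HPt

lemma tendsto_sl {ι : Type*} {l : Filter ι} {f : ι → SL2R} {g : SL2R}
    (h : ∀ i j, Tendsto (fun k => f k i j) l (𝓝 (g i j))) : Tendsto f l (𝓝 g) := by
  rw [nhds_induced, tendsto_comap_iff]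
  exact tendsto_pi_nhds.2 fun i => tendsto_pi_nhds.2 fun j => h i j

/-- Discreteness of (the image in `PSL(2,ℝ)` of) a subgroup of `SL(2,ℝ)`. -/
def Disc (Γ : Subgroup SL2R) : Prop :=
  ∀ u : ℕ → SL2R, (∀ k, u k ∈ Γ) → Tendsto u atTop (𝓝 1) →
    ∃ k, u k ∈ Subgroup.center SL2R

lemma tendsto_base {K : ℕ → HPt} (h : Tendsto (fun k => v base (K k)) atTop (𝓝 1)) :
    Tendsto (fun k => (K k).a) atTop (𝓝 0) ∧ Tendsto (fun k => (K k).b) atTop (𝓝 (-1)) ∧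
    Tendsto (fun k => (K k).c) atTop (𝓝 1) := by
  have h2 : Tendsto (fun k => √((v base (K k))^2 - 1)) atTop (𝓝 0) := by
    have : Tendsto (fun k => √((v base (K k))^2 - 1)) atTop (𝓝 (√(1^2-1))) :=
      (Real.continuous_sqrt.tendsto _).comp ((h.pow 2).sub_const 1)
    simpa using this
  have ha : Tendsto (fun k => (K k).a) atTop (𝓝 0) := by
    refine squeeze_zero_norm (fun k => ?_) h2
    rw [Real.norm_eq_abs]
    apply Real.abs_le_sqrt
    rw [v_base_sq]; nlinarith [sq_nonneg ((K k).b + (K k).c)]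
  have he : Tendsto (fun k => ((K k).b + (K k).c)/2) atTop (𝓝 0) := by
    refine squeeze_zero_norm (fun k => ?_) h2
    rw [Real.norm_eq_abs]
    apply Real.abs_le_sqrt
    rw [v_base_sq]; nlinarith [sq_nonneg ((K k).a)]
  refine ⟨ha, ?_, ?_⟩
  · have := he.sub h
    simp only [v_base] at this
    convert this using 2
    · ring
    · norm_num
  · have := he.add h
    simp only [v_base] at this
    convert this using 2
    · ring
    · norm_num

lemma tendsto_pt {P : HPt} {K : ℕ → HPt} (h : Tendsto (fun k => v P (K k)) atTop (𝓝 1)) :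
    Tendsto (fun k => (K k).a) atTop (𝓝 P.a) ∧ Tendsto (fun k => (K k).b) atTop (𝓝 P.b) ∧
    Tendsto (fun k => (K k).c) atTop (𝓝 P.c) := by
  obtain ⟨g, rfl⟩ := exists_frame P
  have e : ∀ R, act g (act g⁻¹ R) = R := fun R => by rw [← act_mul, mul_inv_cancel, act_one]
  have e1 : ∀ R, v base (act g⁻¹ R) = v (act g base) R := fun R => by
    rw [← v_act g base, e]
  simp only [← e1] at h
  obtain ⟨ha, hb, hc⟩ := tendsto_base h
  have hK : ∀ k, K k = act g (act g⁻¹ (K k)) := fun k => (e _).symm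
  generalize hL : (fun k => act g⁻¹ (K k)) = L at *
  have hL' : ∀ k, act g⁻¹ (K k) = L k := fun k => congrFun hL k
  simp only [hL'] at *
  have hK' : K = fun k => act g (L k) := funext hK
  subst hK'
  simp only [act, base]
  refine ⟨?_, ?_, ?_⟩
  · exact (((ha.const_mul _).add (hc.const_mul _)).mul_const _).sub
      (((hb.const_mul _).sub (ha.const_mul _)).mul_const _)
  · exact (((ha.const_mul _).add (hc.const_mul _)).neg.mul_const _).add
      (((hb.const_mul _).sub (ha.const_mul _)).mul_const _)
  · exact (((ha.const_mul _).add (hc.const_mul _)).mul_const _).sub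
      (((hb.const_mul _).sub (ha.const_mul _)).mul_const _)

lemma tendsto_rot_mul {P : HPt} {K : ℕ → HPt} (h : Tendsto (fun k => v P (K k)) atTop (𝓝 1))
    (θ : ℝ) (g : SL2R) : Tendsto (fun k => (K k).rot θ * g) atTop (𝓝 (P.rot θ * g)) := by
  obtain ⟨ha, hb, hc⟩ := tendsto_pt h
  apply tendsto_sl
  intro i j
  fin_cases i <;> fin_cases j <;>
    simp only [Fin.zero_eta, Fin.mk_one, mul_00, mul_01, mul_10, mul_11, rot_00, rot_01, rot_10,
      rot_11]
  · exact (((ha.const_mul _).const_add _).mul_const _).add ((hb.const_mul _).mul_const _)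
  · exact (((ha.const_mul _).const_add _).mul_const _).add ((hb.const_mul _).mul_const _)
  · exact ((hc.const_mul _).mul_const _).add (((ha.const_mul _).const_sub _).mul_const _)
  · exact ((hc.const_mul _).mul_const _).add (((ha.const_mul _).const_sub _).mul_const _)

lemma rot_inj {P Q : HPt} {θ : ℝ} (hs : Real.sin θ ≠ 0) (h : P.rot θ = Q.rot θ) : P = Q := by
  have h0 := congrArg (fun g : SL2R => g 0 0) h
  have h1 := congrArg (fun g : SL2R => g 0 1) h
  have h2 := congrArg (fun g : SL2R => g 1 0) h
  simp only [rot_00, rot_01, rot_10] at h0 h1 h2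
  refine HPt.ext (mul_left_cancel₀ hs (by linarith)) (mul_left_cancel₀ hs h1)
    (mul_left_cancel₀ hs h2)

/-- The sequence of centers in Jørgensen's argument. -/
def jseq (P Q : HPt) (θ : ℝ) : ℕ → HPt
  | 0 => Q
  | k + 1 => act ((jseq P Q θ k).rot θ) P

/-- Jørgensen's inequality, for two rotations of the same angle. -/
lemma jorgensen {Γ : Subgroup SL2R} (hΓ : Disc Γ) {P Q : HPt} {θ : ℝ} (hs : Real.sin θ ≠ 0)
    (hP : P.rot θ ∈ Γ) (hQ : Q.rot θ ∈ Γ) (hPQ : P ≠ Q) :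
    1 ≤ 2 * (Real.sin θ)^2 * (v P Q + 1) := by
  by_contra! hlt
  set K := jseq P Q θ with hK
  have hmem : ∀ k, (K k).rot θ ∈ Γ := by
    intro k
    induction k with
    | zero => exact hQ
    | succ k ih =>
      change (act ((K k).rot θ) P).rot θ ∈ Γ
      rw [← conj_rot]
      exact Γ.mul_mem (Γ.mul_mem ih hP) (Γ.inv_mem ih)
  have hrec : ∀ k, v P (K (k+1)) - 1 = 2 * (Real.sin θ)^2 * ((v P (K k))^2 - 1) :=
    fun k => v_rot P (K k) θ
  set c := 2 * (Real.sin θ)^2 * (v P Q + 1) with hc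
  have hs2 : 0 < (Real.sin θ)^2 := by positivity
  have hc0 : 0 ≤ c := by have := one_le_v P Q; positivity
  have hb : ∀ k, 0 < v P (K k) - 1 ∧ v P (K k) - 1 ≤ c^k * (v P Q - 1) := by
    intro k
    induction k with
    | zero => exact ⟨by have := one_lt_v hPQ; change 0 < v P Q - 1; linarith, by
        change v P Q - 1 ≤ _; simp⟩
    | succ k ih =>
      obtain ⟨h1, h2⟩ := ih
      have h3 : v P (K k) ≤ v P Q := by
        have : c^k ≤ 1 := pow_le_one₀ hc0 hlt.le
        have := one_le_v P Q
        nlinarith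
      rw [hrec]
      refine ⟨?_, ?_⟩
      · have : 0 < (v P (K k))^2 - 1 := by nlinarith
        positivity
      · have : 2 * (Real.sin θ)^2 * ((v P (K k))^2 - 1) =
          (2 * (Real.sin θ)^2 * (v P (K k) + 1)) * (v P (K k) - 1) := by ring
        rw [this]
        have h4 : 2 * (Real.sin θ)^2 * (v P (K k) + 1) ≤ c := by
          rw [hc]; gcongr
        calc _ ≤ c * (v P (K k) - 1) := mul_le_mul_of_nonneg_right h4 h1.le
          _ ≤ c * (c^k * (v P Q - 1)) := mul_le_mul_of_nonneg_left h2 hc0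
          _ = _ := by ring
  have hlim : Tendsto (fun k => v P (K k)) atTop (𝓝 1) := by
    have h1 : Tendsto (fun k => c^k * (v P Q - 1)) atTop (𝓝 0) := by
      simpa using (tendsto_pow_atTop_nhds_zero_of_lt_one hc0 hlt).mul_const (v P Q - 1)
    have h2 : Tendsto (fun k => v P (K k) - 1) atTop (𝓝 0) :=
      squeeze_zero (fun k => (hb k).1.le) (fun k => (hb k).2) h1
    simpa using h2.add_const 1
  have ht := tendsto_rot_mul hlim θ (P.rot θ)⁻¹
  rw [mul_inv_cancel] at ht
  obtain ⟨k, hk⟩ := hΓ _ (fun k => Γ.mul_mem (hmem k) (Γ.inv_mem hP)) ht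
  have hne : P ≠ K k := fun h => by
    have := (hb k).1
    rw [← h, v_self] at this; simp at this
  rw [mem_center_iff'] at hk
  rcases hk with hk | hk
  · rw [mul_inv_eq_one] at hk
    exact hne (rot_inj hs hk.symm)
  · rw [mul_inv_eq_iff_eq_mul] at hk
    have h2 := congrArg (fun g : SL2R => g 1 0) hk
    simp only [neg_mul, one_mul, rot_10, Matrix.SpecialLinearGroup.coe_neg, Matrix.neg_apply] at h2
    have h3 : Real.sin θ * ((K k).c + P.c) = 0 := by linarith
    have := P.hc
    have := (K k).hc
    rcases mul_eq_zero.1 h3 with h | h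
    · exact hs h
    · linarith

/-- The stabilizer of a point is cyclic. -/
lemma exists_order {Γ : Subgroup SL2R} (hΓ : Disc Γ) (hneg : (-1 : SL2R) ∈ Γ) (P : HPt) :
    ∃ m : ℕ, 1 ≤ m ∧ ∀ θ, P.rot θ ∈ Γ ↔ ∃ k : ℤ, θ = k * (Real.pi / m) := by
  let S : AddSubgroup ℝ :=
    { carrier := {θ | P.rot θ ∈ Γ}
      add_mem' := fun {a b} ha hb => by
        simp only [Set.mem_ofPred_eq] at *; rw [rot_add]; exact Γ.mul_mem ha hb
      zero_mem' := by simp only [Set.mem_ofPred_eq]; rw [rot_zero]; exact Γ.one_mem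
      neg_mem' := fun {a} ha => by
        simp only [Set.mem_ofPred_eq] at *; rw [rot_neg]; exact Γ.inv_mem ha }
  have hS : ∀ θ, θ ∈ S ↔ P.rot θ ∈ Γ := fun θ => Iff.rfl
  have hpi : Real.pi ∈ S := by
    rw [hS]
    convert hneg
    apply sl_ext <;> simp [rot_00, rot_01, rot_10, rot_11]
  rcases AddSubgroup.dense_or_cyclic S with hd | ⟨a, ha⟩
  · exfalso
    have hex : ∀ k : ℕ, ∃ θ ∈ S, 0 < θ ∧ θ < 1 / ((k:ℝ) + 1) := by
      intro k
      obtain ⟨θ, h1, h2⟩ := hd.exists_between (show (0:ℝ) < 1 / ((k:ℝ)+1) by positivity)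
      exact ⟨θ, h1, h2.1, h2.2⟩
    choose t ht1 ht2 ht3 using hex
    have ht : Tendsto t atTop (𝓝 0) :=
      squeeze_zero (fun k => (ht2 k).le) (fun k => (ht3 k).le) tendsto_one_div_add_atTop_nhds_zero_nat
    have hsin : Tendsto (fun k => Real.sin (t k)) atTop (𝓝 0) := by
      have := (Real.continuous_sin.tendsto 0).comp ht
      rw [Real.sin_zero] at this; exact this
    have hcos : Tendsto (fun k => Real.cos (t k)) atTop (𝓝 1) := by
      have := (Real.continuous_cos.tendsto 0).comp ht
      rw [Real.cos_zero] at this; exact this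
    have hlim : Tendsto (fun k => P.rot (t k)) atTop (𝓝 1) := by
      apply tendsto_sl
      intro i j
      fin_cases i <;> fin_cases j <;>
        simp only [Fin.zero_eta, Fin.mk_one, rot_00, rot_01, rot_10, rot_11]
      · simpa using hcos.add (hsin.mul_const P.a)
      · simpa using (hsin.mul_const P.b)
      · simpa using (hsin.mul_const P.c)
      · simpa using hcos.sub (hsin.mul_const P.a)
    obtain ⟨k, hk⟩ := hΓ _ (fun k => ht1 k) hlim
    rw [rot_mem_center] at hk
    have h1 : t k < 1 := lt_of_lt_of_le (ht3 k) (by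
      rw [div_le_one (by positivity)]; linarith [(Nat.cast_nonneg k : (0:ℝ) ≤ k)])
    exact (Real.sin_pos_of_pos_of_lt_pi (ht2 k) (by linarith [Real.pi_gt_three])).ne' hk
  · have hmem : ∀ θ, θ ∈ S ↔ ∃ k : ℤ, θ = k * a := by
      intro θ
      rw [ha, ← AddSubgroup.zmultiples_eq_closure, AddSubgroup.mem_zmultiples_iff]
      constructor
      · rintro ⟨k, hk⟩; exact ⟨k, by rw [← hk]; simp⟩
      · rintro ⟨k, hk⟩; exact ⟨k, by rw [hk]; simp⟩
    obtain ⟨k, hk⟩ := (hmem _).1 hpi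
    have hk0 : k ≠ 0 := by rintro rfl; simp at hk
    refine ⟨k.natAbs, Int.natAbs_pos.2 hk0, fun θ => ?_⟩
    rw [← hS, hmem]
    have hkr : (k:ℝ) ≠ 0 := by exact_mod_cast hk0
    have hcast : ((k.natAbs : ℕ) : ℝ) = |(k:ℝ)| := by
      rw [Nat.cast_natAbs]; push_cast; rfl
    rw [hcast]
    rcases lt_or_gt_of_ne hkr with h | h
    · rw [abs_of_neg h]
      have e : Real.pi / (-(k:ℝ)) = -a := by rw [hk]; field_simp
      rw [e]
      constructor
      · rintro ⟨j, hj⟩; exact ⟨-j, by rw [hj]; push_cast; ring⟩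
      · rintro ⟨j, hj⟩; exact ⟨-j, by rw [hj]; push_cast; ring⟩
    · rw [abs_of_pos h]
      have e : Real.pi / (k:ℝ) = a := by rw [hk]; field_simp
      rw [e]

end HPt
end

noncomputable section
namespace HPt

lemma zpow_formula {F : Type*} [Field F] (M : Matrix.SpecialLinearGroup (Fin 2) F) (l : F)
    (hl : l ≠ 0) (ht : M 0 0 + M 1 1 = l + l⁻¹) (n : ℤ) :
    (l - l⁻¹) • ((M ^ n : Matrix.SpecialLinearGroup (Fin 2) F) : Matrix (Fin 2) (Fin 2) F) =
      (l ^ n - l ^ (-n)) • (M : Matrix (Fin 2) (Fin 2) F) - (l ^ (n-1) - l ^ (1-n)) • 1 := by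
  have hdet : M 0 0 * M 1 1 - M 0 1 * M 1 0 = 1 := by
    have := M.det_coe
    rwa [Matrix.det_fin_two] at this
  have hM : (M : Matrix (Fin 2) (Fin 2) F) * M = (l + l⁻¹) • (M : Matrix (Fin 2) (Fin 2) F) - 1 := by
    ext i j
    fin_cases i <;> fin_cases j <;>
      simp [Matrix.mul_apply, Fin.sum_univ_two, ← ht] <;> first | ring1 | linear_combination -hdet
  have hI : ((M⁻¹ : Matrix.SpecialLinearGroup (Fin 2) F) : Matrix (Fin 2) (Fin 2) F) =
      (l + l⁻¹) • 1 - (M : Matrix (Fin 2) (Fin 2) F) := by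
    ext i j
    fin_cases i <;> fin_cases j <;>
      simp [Matrix.SpecialLinearGroup.coe_inv, Matrix.adjugate_fin_two, ← ht]
  have hMI : (M : Matrix (Fin 2) (Fin 2) F) * ((M⁻¹ : Matrix.SpecialLinearGroup (Fin 2) F) : Matrix (Fin 2) (Fin 2) F) = 1 := by
    rw [← Matrix.SpecialLinearGroup.coe_mul, mul_inv_cancel, Matrix.SpecialLinearGroup.coe_one]
  have key : ∀ k : ℤ, (l ^ (k+1) - l ^ (-(k+1))) = (l ^ k - l ^ (-k)) * (l + l⁻¹) - (l ^ (k-1) - l ^ (1-k)) := by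
    intro k
    rw [zpow_add₀ hl, zpow_sub₀ hl, zpow_sub₀ hl, neg_add, zpow_add₀ hl, zpow_neg]
    simp only [zpow_one, zpow_neg]
    field_simp
    ring
  induction n using Int.induction_on with
  | zero =>
    simp [← sub_smul]
    rw [← neg_smul]; congr 1; ring
  | succ k ih =>
    rw [zpow_add_one, Matrix.SpecialLinearGroup.coe_mul, ← smul_mul_assoc, ih, sub_mul,
      smul_mul_assoc, hM, key k, add_sub_cancel_right, smul_mul_assoc, one_mul,
      show (1 - ((k:ℤ)+1)) = -k by ring]
    module
  | pred k ih =>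
    have h1 := key (-(k:ℤ) - 1)
    rw [zpow_sub_one, Matrix.SpecialLinearGroup.coe_mul, ← smul_mul_assoc, ih, sub_mul,
      smul_mul_assoc, hMI, smul_mul_assoc, one_mul, hI]
    have e1 : (1 - (-(k:ℤ) - 1)) = 2 + k := by ring
    have e2 : -(-(k:ℤ) - 1) = 1 + k := by ring
    have e3 : (1 - (-(k:ℤ))) = 1 + k := by ring
    have e4 : (-(k:ℤ) - 1 + 1) = -k := by ring
    rw [e1, e2, e4, neg_neg] at h1
    rw [e1, e2, e3, neg_neg, h1]
    module

lemma comm_identity (A B : SL2R) (hx : A 0 0 + A 1 1 = B 0 0 + B 1 1) :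
    (A : Matrix (Fin 2) (Fin 2) ℝ) * ((A * B⁻¹ * A⁻¹ * B : SL2R) : Matrix (Fin 2) (Fin 2) ℝ)
     - ((A * B⁻¹ * A⁻¹ * B : SL2R) : Matrix (Fin 2) (Fin 2) ℝ) * B
     = ((A*B) 0 0 + (A*B) 1 1 - 1) • ((A : Matrix (Fin 2) (Fin 2) ℝ) - B) := by
  have hA := det_eq A
  have hB := det_eq B
  obtain ⟨x, hx1⟩ : ∃ x, x = A 0 0 + A 1 1 := ⟨_, rfl⟩
  have hx2 : x = B 0 0 + B 1 1 := by rw [hx1, hx]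
  have hAA : (A : Matrix (Fin 2) (Fin 2) ℝ) * A = x • (A : Matrix (Fin 2) (Fin 2) ℝ) - 1 := by
    ext i j
    fin_cases i <;> fin_cases j <;>
      simp [Matrix.mul_apply, Fin.sum_univ_two, hx1] <;> first | ring1 | linear_combination -hA
  have hBB : (B : Matrix (Fin 2) (Fin 2) ℝ) * B = x • (B : Matrix (Fin 2) (Fin 2) ℝ) - 1 := by
    ext i j
    fin_cases i <;> fin_cases j <;>
      simp [Matrix.mul_apply, Fin.sum_univ_two, hx2] <;> first | ring1 | linear_combination -hB
  have hAi : ((A⁻¹ : SL2R) : Matrix (Fin 2) (Fin 2) ℝ) =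
      x • 1 - (A : Matrix (Fin 2) (Fin 2) ℝ) := by
    ext i j
    fin_cases i <;> fin_cases j <;>
      simp [Matrix.SpecialLinearGroup.coe_inv, Matrix.adjugate_fin_two, hx1]
  have hBi : ((B⁻¹ : SL2R) : Matrix (Fin 2) (Fin 2) ℝ) =
      x • 1 - (B : Matrix (Fin 2) (Fin 2) ℝ) := by
    ext i j
    fin_cases i <;> fin_cases j <;>
      simp [Matrix.SpecialLinearGroup.coe_inv, Matrix.adjugate_fin_two, hx2]
  have hABA : (A : Matrix (Fin 2) (Fin 2) ℝ) * B * A =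
      ((A*B) 0 0 + (A*B) 1 1) • (A : Matrix (Fin 2) (Fin 2) ℝ) - (x • 1 - B) := by
    ext i j
    fin_cases i <;> fin_cases j <;>
      simp [Matrix.mul_apply, Fin.sum_univ_two, hx2]
    · linear_combination (-B 1 1) * hA
    · linear_combination (B 0 1) * hA
    · linear_combination (B 1 0) * hA
    · linear_combination (-B 0 0) * hA
  have hBAB : (B : Matrix (Fin 2) (Fin 2) ℝ) * A * B =
      ((A*B) 0 0 + (A*B) 1 1) • (B : Matrix (Fin 2) (Fin 2) ℝ) - (x • 1 - A) := by
    ext i j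
    fin_cases i <;> fin_cases j <;>
      simp [Matrix.mul_apply, Fin.sum_univ_two, hx1]
    · linear_combination (-A 1 1) * hB
    · linear_combination (A 0 1) * hB
    · linear_combination (A 1 0) * hB
    · linear_combination (-A 0 0) * hB
  generalize ((A*B) 0 0 + (A*B) 1 1) = t at *
  simp only [Matrix.SpecialLinearGroup.coe_mul, hAi, hBi]
  generalize (A : Matrix (Fin 2) (Fin 2) ℝ) = a at *
  generalize (B : Matrix (Fin 2) (Fin 2) ℝ) = b at *
  have e1 : a * (a * (x • 1 - b) * (x • 1 - a) * b) = x • (a * (x • 1 - b) * (x • 1 - a) * b)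
      - (x • 1 - b) * (x • 1 - a) * b := by
    rw [← mul_assoc, ← mul_assoc, ← mul_assoc, hAA]
    simp only [sub_mul, one_mul, smul_mul_assoc]
  have e2 : (a * (x • 1 - b) * (x • 1 - a) * b) * b = x • (a * (x • 1 - b) * (x • 1 - a) * b)
      - a * (x • 1 - b) * (x • 1 - a) := by
    rw [mul_assoc _ b b, hBB, mul_sub, mul_one, mul_smul_comm]
  rw [e1, e2]
  have e3 : a * (x • 1 - b) * (x • 1 - a) = (x*x) • a - x • (a * a) - x • (a * b) + a * b * a := by
    simp only [mul_sub, sub_mul, mul_smul_comm, smul_mul_assoc, mul_one, one_mul]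
    module
  have e4 : (x • 1 - b) * (x • 1 - a) * b = (x*x) • b - x • (b * b) - x • (a * b) + b * a * b := by
    simp only [mul_sub, sub_mul, mul_smul_comm, smul_mul_assoc, mul_one, one_mul]
    module
  rw [e3, e4, hAA, hBB, hABA, hBAB]
  module

lemma trace_rot_mul (P Q : HPt) (θ : ℝ) :
    (P.rot θ * Q.rot θ) 0 0 + (P.rot θ * Q.rot θ) 1 1 =
      2 * (Real.cos θ)^2 - 2 * (Real.sin θ)^2 * v P Q := by
  simp only [mul_00, mul_11, rot_00, rot_01, rot_10, rot_11, v]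
  ring

lemma trace_comm (A B : SL2R) (hx : A 0 0 + A 1 1 = B 0 0 + B 1 1) :
    (A * B⁻¹ * A⁻¹ * B) 0 0 + (A * B⁻¹ * A⁻¹ * B) 1 1 =
    2 * (A 0 0 + A 1 1)^2 + ((A*B) 0 0 + (A*B) 1 1)^2
      - (A 0 0 + A 1 1)^2 * ((A*B) 0 0 + (A*B) 1 1) - 2 := by
  have hA := det_eq A
  have hB := det_eq B
  simp only [mul_00, mul_11, mul_01, mul_10, inv_00, inv_01, inv_10, inv_11]
  generalize A 0 0 = a at *
  generalize A 0 1 = b at *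
  generalize A 1 0 = c at *
  generalize A 1 1 = d at *
  generalize B 0 0 = e at *
  generalize B 0 1 = f at *
  generalize B 1 0 = g at *
  generalize B 1 1 = h at *
  linear_combination ((a+d)^2 - 2) * hB + ((e+h)^2 - 2*(e*h-f*g)) * hA
    + ((a+d)*(a*e+b*g+(c*f+d*h)) - (a+d) - (e+h)) * hx

lemma exists_lam {z : ℝ} (hz : 2 < z) : ∃ l : ℝ, 1 < l ∧ l + l⁻¹ = z := by
  have h1 : 0 < z^2 - 4 := by nlinarith
  have h2 := Real.sq_sqrt h1.le
  have h3 := Real.sqrt_nonneg (z^2-4)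
  have h4 : 0 < (z + √(z^2-4))/2 := by linarith
  refine ⟨(z + √(z^2-4))/2, by linarith, ?_⟩
  have : ((z + √(z^2-4))/2)⁻¹ = (z - √(z^2-4))/2 := by
    rw [inv_eq_iff_eq_inv, eq_comm, inv_eq_iff_eq_inv, eq_comm]
    exact inv_eq_of_mul_eq_one_right (by nlinarith)
  rw [this]; ring

lemma stepB {Γ : Subgroup SL2R} (hΓ : Disc Γ) {P Q : HPt} {θ : ℝ} (hs : Real.sin θ ≠ 0)
    (hP : P.rot θ ∈ Γ) (hQ : Q.rot θ ∈ Γ) (hPQ : P ≠ Q) {n : ℤ}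
    (hrel : P.rot θ * (P.rot θ * (Q.rot θ)⁻¹ * (P.rot θ)⁻¹ * Q.rot θ) ^ n =
      (P.rot θ * (Q.rot θ)⁻¹ * (P.rot θ)⁻¹ * Q.rot θ) ^ n * Q.rot θ) :
    n = 1 ∧ 2 * (Real.sin θ)^2 * (v P Q + 1) = 1 := by
  have hj := jorgensen hΓ hs hP hQ hPQ
  have hv := one_lt_v hPQ
  have hx : (P.rot θ) 0 0 + (P.rot θ) 1 1 = (Q.rot θ) 0 0 + (Q.rot θ) 1 1 := by
    simp only [rot_00, rot_11]; ring
  have hx' : (P.rot θ) 0 0 + (P.rot θ) 1 1 = 2 * Real.cos θ := by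
    simp only [rot_00, rot_11]; ring
  have hid := comm_identity _ _ hx
  have htr := trace_comm _ _ hx
  rw [trace_rot_mul] at hid htr
  rw [hx'] at htr
  set W := P.rot θ * (Q.rot θ)⁻¹ * (P.rot θ)⁻¹ * Q.rot θ with hW
  have hcs := Real.sin_sq_add_cos_sq θ
  have hz : W 0 0 + W 1 1 = 2 + 4 * (Real.sin θ)^4 * ((v P Q)^2 - 1) := by
    rw [htr]
    have : (Real.cos θ)^2 = 1 - (Real.sin θ)^2 := by linarith
    simp only [mul_pow, this]; ring
  have hz2 : 2 < W 0 0 + W 1 1 := by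
    have : 0 < (v P Q)^2 - 1 := by nlinarith
    rw [hz]
    have : 0 < 4 * (Real.sin θ)^4 * ((v P Q)^2 - 1) := by positivity
    linarith
  obtain ⟨l, hl1, hl⟩ := exists_lam hz2
  have hf := zpow_formula W l (by positivity) hl.symm n
  have hrel' : (P.rot θ : Matrix (Fin 2) (Fin 2) ℝ) * ((W ^ n : SL2R) : Matrix (Fin 2) (Fin 2) ℝ)
     = ((W ^ n : SL2R) : Matrix (Fin 2) (Fin 2) ℝ) * (Q.rot θ : Matrix (Fin 2) (Fin 2) ℝ) := by
    rw [← Matrix.SpecialLinearGroup.coe_mul, hrel, Matrix.SpecialLinearGroup.coe_mul]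
  have h5 : (P.rot θ : Matrix (Fin 2) (Fin 2) ℝ) * ((l - l⁻¹) • ((W ^ n : SL2R) : Matrix (Fin 2) (Fin 2) ℝ))
     = ((l - l⁻¹) • ((W ^ n : SL2R) : Matrix (Fin 2) (Fin 2) ℝ)) * (Q.rot θ : Matrix (Fin 2) (Fin 2) ℝ) := by
    rw [mul_smul_comm, hrel', smul_mul_assoc]
  rw [hf, mul_sub, sub_mul, mul_smul_comm, smul_mul_assoc, mul_smul_comm, smul_mul_assoc, mul_one,
    one_mul] at h5
  set u := 2 * (Real.cos θ)^2 - 2 * (Real.sin θ)^2 * v P Q - 1 with hu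
  have hu' : u = 1 - 2 * (Real.sin θ)^2 * (v P Q + 1) := by rw [hu]; linarith
  have h6 : ((l ^ n - l ^ (-n)) * u - (l ^ (n-1) - l ^ (1-n))) •
      ((P.rot θ : Matrix (Fin 2) (Fin 2) ℝ) - (Q.rot θ : Matrix (Fin 2) (Fin 2) ℝ)) = 0 := by
    rw [sub_smul, mul_smul, ← hid, smul_sub, smul_sub]
    rw [sub_eq_iff_eq_add] at h5
    rw [h5]; abel
  have h7 : (l ^ n - l ^ (-n)) * u = (l ^ (n-1) - l ^ (1-n)) := by
    rcases smul_eq_zero.1 h6 with h | h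
    · linarith
    · exact absurd (rot_inj hs (Subtype.ext (sub_eq_zero.1 h))) hPQ
  have hu0 : u ≤ 0 := by linarith
  have hpos : ∀ k : ℤ, 0 < k → 0 < l ^ k - l ^ (-k) := by
    intro k hk
    have h1 : 1 < l ^ k := one_lt_zpow₀ hl1 hk
    have h2 : l ^ (-k) < 1 := zpow_lt_one_of_neg₀ hl1 (by omega)
    linarith
  have hneg : 1 - n = -(n-1) := by ring
  rw [hneg] at h7
  have hn : n = 1 := by
    by_contra hn
    rcases lt_trichotomy n 0 with h | h | h
    · have h1 := hpos (-n) (by omega)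
      have h2 := hpos (-(n-1)) (by omega)
      rw [neg_neg] at h1 h2
      nlinarith
    · subst h
      have h2 := hpos 1 (by omega)
      simp at h7 h2; linarith
    · have h1 := hpos n h
      have h2 := hpos (n-1) (by omega)
      nlinarith
  refine ⟨hn, ?_⟩
  subst hn
  have h1 := hpos 1 (by omega)
  simp only [sub_self, zpow_zero, neg_zero] at h7
  rcases mul_eq_zero.1 h7 with h | h
  · exact absurd h h1.ne'
  · linarith

end HPt
end

noncomputable section
namespace HPt

lemma rot_act_mem {Γ : Subgroup SL2R} {P : HPt} {h : SL2R} {θ : ℝ} (hh : h ∈ Γ) (hP : P.rot θ ∈ Γ) :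
    (act h P).rot θ ∈ Γ := by
  rw [← conj_rot]
  exact Γ.mul_mem (Γ.mul_mem hh hP) (Γ.inv_mem hh)

lemma sin_pi_div_pos {m : ℕ} (hm : 2 ≤ m) : 0 < Real.sin (Real.pi / m) := by
  have hm' : (2:ℝ) ≤ m := by exact_mod_cast hm
  apply Real.sin_pos_of_pos_of_lt_pi
  · have := Real.pi_pos; positivity
  · rw [div_lt_iff₀ (by linarith)]; nlinarith [Real.pi_pos]

/-- `sin` is minimal at the ends. -/
lemma sin_aux {m i : ℕ} (h1 : 2 ≤ i) (h2 : i + 2 ≤ m) :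
    Real.sin (Real.pi / m) < Real.sin (i * (Real.pi / m)) := by
  have hpi := Real.pi_pos
  have hm' : (0:ℝ) < m := by exact_mod_cast (by omega : 0 < m)
  have hd : 0 < Real.pi / m := by positivity
  have hdm : m * (Real.pi / m) = Real.pi := by field_simp
  have key : ∀ j : ℕ, 2 ≤ j → 2 * j ≤ m → Real.sin (Real.pi / m) < Real.sin (j * (Real.pi / m)) := by
    intro j hj1 hj2
    have hj1' : (2:ℝ) ≤ j := by exact_mod_cast hj1
    have hj2' : 2 * (j:ℝ) ≤ m := by exact_mod_cast hj2
    apply Real.strictMonoOn_sin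
    · constructor <;> nlinarith
    · constructor <;> nlinarith
    · nlinarith
  by_cases h : 2 * i ≤ m
  · exact key i h1 h
  · have := key (m - i) (by omega) (by omega)
    rw [Nat.cast_sub (by omega), sub_mul, hdm, Real.sin_pi_sub] at this
    exact this

lemma stepC {Γ : Subgroup SL2R} (hΓ : Disc Γ) {P Q : HPt} {θ : ℝ} (hs : Real.sin θ ≠ 0)
    (hP : P.rot θ ∈ Γ) {w : SL2R} (hw : w ∈ Γ) (hQ : Q = act w P) (hPQ : P ≠ Q)
    (hv : 2 * (Real.sin θ)^2 * (v P Q + 1) = 1)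
    {m : ℕ} (hm1 : 1 ≤ m) (hm : ∀ θ, P.rot θ ∈ Γ ↔ ∃ k : ℤ, θ = k * (Real.pi / m)) :
    2 ≤ m ∧ 2 * (Real.sin (Real.pi / m))^2 * (v P Q + 1) = 1 ∧
     ∃ j : ℤ, θ = Real.pi / m + j * Real.pi ∨ θ = - (Real.pi / m) + j * Real.pi := by
  have hm0 : (m:ℝ) ≠ 0 := by exact_mod_cast (by omega : m ≠ 0)
  obtain ⟨k, hk⟩ := (hm θ).1 hP
  have hm2 : 2 ≤ m := by
    by_contra h
    have : m = 1 := by omega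
    subst this
    apply hs; rw [hk]; simp
  refine ⟨hm2, ?_⟩
  have hs0 := sin_pi_div_pos hm2
  have hPm : P.rot (Real.pi / m) ∈ Γ := (hm _).2 ⟨1, by simp⟩
  have hj := jorgensen hΓ hs0.ne' hPm (by rw [hQ]; exact rot_act_mem hw hPm) hPQ
  have hvpos : 0 < v P Q + 1 := by linarith [one_le_v P Q]
  have hle : (Real.sin θ)^2 ≤ (Real.sin (Real.pi/m))^2 := by
    by_contra! h
    nlinarith
  obtain ⟨i, hi⟩ : ∃ i : ℕ, (i:ℤ) = k % m := ⟨(k % m).toNat, by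
    rw [Int.toNat_of_nonneg (Int.emod_nonneg _ (by omega))]⟩
  have him : i < m := by
    have := Int.emod_lt_of_pos k (by omega : (0:ℤ) < m)
    omega
  have hk2 : k = m * (k / m) + i := by rw [hi]; exact (Int.mul_ediv_add_emod k m).symm
  have hth : θ = i * (Real.pi / m) + (k / m : ℤ) * Real.pi := by
    have : (k:ℝ) = m * (k / m : ℤ) + i := by exact_mod_cast hk2
    rw [hk, this]; field_simp; ring
  have hsq : (Real.sin θ)^2 = (Real.sin (i * (Real.pi / m)))^2 := by
    rw [hth, Real.sin_add_int_mul_pi, mul_pow]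
    rw [← zpow_natCast, ← zpow_mul, mul_comm _ ((2:ℕ):ℤ), zpow_mul]; simp
  have hi0 : i ≠ 0 := by
    rintro rfl
    apply hs
    have : (Real.sin θ)^2 = 0 := by rw [hsq]; simp
    exact pow_eq_zero_iff (two_ne_zero) |>.1 this
  have hcase : i = 1 ∨ i + 1 = m := by
    by_contra hne
    have := sin_aux (m := m) (i := i) (by omega) (by omega)
    nlinarith
  have hend : θ = Real.pi / m + (k / m : ℤ) * Real.pi ∨
      θ = - (Real.pi / m) + ((k / m : ℤ) + 1 : ℤ) * Real.pi := by
    rcases hcase with h | h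
    · left; rw [hth, h]; simp
    · right
      have : (i:ℝ) = m - 1 := by rw [← h]; push_cast; ring
      rw [hth, this]; push_cast; field_simp; ring
  refine ⟨?_, ?_⟩
  · have : (Real.sin θ)^2 = (Real.sin (Real.pi/m))^2 := by
      rcases hend with h | h <;>
      · rw [h, Real.sin_add_int_mul_pi, mul_pow]
        rw [← zpow_natCast, ← zpow_mul, mul_comm _ ((2:ℕ):ℤ), zpow_mul]; simp
    rw [← this, hv]
  · rcases hend with h | h
    · exact ⟨_, Or.inl h⟩
    · exact ⟨_, Or.inr h⟩

lemma stepD {Γ : Subgroup SL2R} (hΓ : Disc Γ) {P Q : HPt} {w : SL2R} (hw : w ∈ Γ)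
    (hQ : Q = act w P) (hPQ : P ≠ Q) {m : ℕ} (hm2 : 2 ≤ m) (hPm : P.rot (Real.pi / m) ∈ Γ)
    (hv : 2 * (Real.sin (Real.pi / m))^2 * (v P Q + 1) = 1)
    {R : HPt} {k : ℕ} (hk : 4 ≤ k) (hR : R.rot (Real.pi / k) ∈ Γ) : ∃ h ∈ Γ, R = act h P := by
  by_contra! hno
  have hpi := Real.pi_pos
  have hs0 := sin_pi_div_pos hm2
  have hsk := sin_pi_div_pos (m := k) (by omega)
  have hV := one_lt_v hPQ
  set V := v P Q with hVdef
  have hsk2 : (Real.sin (Real.pi / k))^2 ≤ 1/2 := by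
    have h4 : Real.sin (Real.pi / k) ≤ Real.sin (Real.pi / 4) := by
      have hk' : (4:ℝ) ≤ k := by exact_mod_cast hk
      have : Real.pi / k ≤ Real.pi / 4 := by gcongr
      apply Real.strictMonoOn_sin.monotoneOn
      · constructor <;> [skip; linarith]
        have : 0 ≤ Real.pi / k := by positivity
        linarith
      · constructor <;> linarith
      · exact this
    calc _ ≤ (Real.sin (Real.pi / 4))^2 := by gcongr
      _ = 1/2 := by
        rw [Real.sin_pi_div_four, div_pow, Real.sq_sqrt (by norm_num)]; norm_num
  have hfar : ∀ h ∈ Γ, V ≤ (v (act h P) R)^2 := by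
    intro h hh
    have hne : act h P ≠ R := fun e => hno h hh e.symm
    have h1 := one_lt_v hne
    have h2 := v_rot (act h P) R (Real.pi / k)
    have h3 : 0 < v (act h P) (act (R.rot (Real.pi/k)) (act h P)) - 1 := by
      rw [h2]
      have : 0 < (v (act h P) R)^2 - 1 := by nlinarith
      positivity
    have h4 : act h P ≠ act (R.rot (Real.pi/k)) (act h P) := by
      intro e
      rw [← e, v_self] at h3; simp at h3
    have h5 := jorgensen hΓ hs0.ne' (rot_act_mem hh hPm)
      (rot_act_mem hR (rot_act_mem hh hPm)) h4
    have h6 : V ≤ v (act h P) (act (R.rot (Real.pi/k)) (act h P)) := by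
      by_contra! hlt
      have : 0 < (Real.sin (Real.pi / m))^2 := by positivity
      nlinarith
    have h7 : 0 ≤ (v (act h P) R)^2 - 1 := by nlinarith
    have h8 := mul_le_mul_of_nonneg_right hsk2 h7
    nlinarith
  set c := Real.cos (Real.pi / m) with hc
  have hc0 : 0 ≤ c := by
    apply Real.cos_nonneg_of_neg_pi_div_two_le_of_le
    · have : 0 ≤ Real.pi / m := by positivity
      linarith
    · have : (2:ℝ) ≤ m := by exact_mod_cast hm2
      gcongr
  have hc2 : c^2 * (2 * (V + 1)) = 2 * V + 1 := by
    have := Real.sin_sq_add_cos_sq (Real.pi / m)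
    rw [← hc] at this
    have e : c^2 = 1 - (Real.sin (Real.pi / m))^2 := by linarith
    rw [e]; linarith
  set t := √((2*V+1)/(2*V)) with ht
  have ht2 : t^2 = (2*V+1)/(2*V) := Real.sq_sqrt (by positivity)
  have ht1 : 1 < t := by
    rw [ht, Real.lt_sqrt (by norm_num), one_pow, one_lt_div (by positivity)]; linarith
  set η := (V - 1) * (t - 1) with hη
  have hη0 : 0 < η := mul_pos (by linarith) (by linarith)
  have hstep : ∀ h ∈ Γ, ∃ h' ∈ Γ, v (act h' P) R ≤ v (act h P) R - η := by
    intro h hh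
    obtain ⟨l, hl⟩ := neighbour (act h P) (act h Q) R m (by omega)
    have hmem : (act h P).rot (l * (Real.pi / m)) ∈ Γ := by
      rw [rot_int]; exact Γ.zpow_mem (rot_act_mem hh hPm) l
    refine ⟨(act h P).rot (l * (Real.pi / m)) * h * w, Γ.mul_mem (Γ.mul_mem hmem hh) hw, ?_⟩
    rw [act_mul, act_mul, ← hQ]
    refine hl.trans ?_
    rw [v_act, ← hVdef, ← hc]
    set x := v (act h P) R with hx
    have hx1 : 1 ≤ x := one_le_v _ _
    have hxV := hfar h hh
    have hk : (V - 1) * t * x ≤ √(V^2 - 1) * √(x^2-1) * c := by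
      rw [← Real.sqrt_mul (by nlinarith)]
      apply le_of_sq_le_sq _ (by positivity)
      rw [mul_pow, mul_pow, mul_pow, Real.sq_sqrt (mul_nonneg (by nlinarith) (by nlinarith)), ht2]
      have hc2' : c^2 = (2*V+1)/(2*(V+1)) := by
        rw [eq_div_iff (by positivity)]; exact hc2
      rw [hc2']
      have e1 : (V^2 - 1) * (x^2-1) * ((2*V+1)/(2*(V+1))) = (V-1) * (2*V+1) * (x^2-1) / 2 := by
        field_simp; ring
      have e2 : (V-1)^2 * ((2*V+1)/(2*V)) * x^2 = (V-1) * (2*V+1) * ((V-1) * x^2 / V) / 2 := by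
        field_simp
      rw [e1, e2]
      have e3 : (V-1) * x^2 / V ≤ x^2-1 := by
        rw [div_le_iff₀ (by positivity)]; nlinarith
      have : 0 ≤ (V-1) * (2*V+1) := mul_nonneg (by linarith) (by linarith)
      nlinarith
    nlinarith
  have hit : ∀ j : ℕ, ∃ h ∈ Γ, v (act h P) R ≤ v P R - j * η := by
    intro j
    induction j with
    | zero => exact ⟨1, Γ.one_mem, by rw [act_one]; simp⟩
    | succ j ih =>
      obtain ⟨h, hh, h1⟩ := ih
      obtain ⟨h', hh', h2⟩ := hstep h hh
      exact ⟨h', hh', by push_cast; linarith⟩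
  obtain ⟨j, hj⟩ := exists_nat_gt (v P R / η)
  obtain ⟨h, hh, h1⟩ := hit j
  have := one_le_v (act h P) R
  rw [div_lt_iff₀ hη0] at hj
  linarith

end HPt
end

noncomputable section
open Filter Topology
namespace HPt

/-- The full preimage of a subgroup of `PSL(2,ℝ)`. -/
def pre (Δ : Subgroup PSL2R) : Subgroup SL2R := Δ.comap (QuotientGroup.mk' (Subgroup.center SL2R))

lemma mem_pre {Δ : Subgroup PSL2R} {M : SL2R} : M ∈ pre Δ ↔ (M : PSL2R) ∈ Δ := Iff.rfl

lemma neg_one_center : (-1 : SL2R) ∈ Subgroup.center SL2R := (mem_center_iff' _).2 (Or.inr rfl)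

lemma mk_eq_one {M : SL2R} : (M : PSL2R) = 1 ↔ M = 1 ∨ M = -1 := by
  rw [QuotientGroup.eq_one_iff, mem_center_iff']

lemma mk_eq {M N : SL2R} : (M : PSL2R) = N ↔ M = N ∨ M = -N := by
  rw [eq_comm, QuotientGroup.eq, mem_center_iff', inv_mul_eq_iff_eq_mul, inv_mul_eq_iff_eq_mul]
  simp

lemma neg_one_mem_pre (Δ : Subgroup PSL2R) : (-1 : SL2R) ∈ pre Δ := by
  rw [mem_pre, (QuotientGroup.eq_one_iff _).2 neg_one_center]; exact Δ.one_mem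

lemma disc_pre (Δ : Subgroup PSL2R) (hdisc : DiscreteTopology ↥Δ) : Disc (pre Δ) := by
  intro u hu ht
  have hc : Continuous (fun M : SL2R => (M : PSL2R)) := continuous_quot_mk
  have h1 : Tendsto (fun k => (u k : PSL2R)) atTop (𝓝 ((1 : SL2R) : PSL2R)) :=
    (hc.tendsto 1).comp ht
  have h2 : Tendsto (fun k => (⟨(u k : PSL2R), hu k⟩ : Δ)) atTop (𝓝 1) := by
    rw [tendsto_subtype_rng]
    exact h1
  rw [nhds_discrete, tendsto_pure] at h2
  obtain ⟨k, hk⟩ := h2.exists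
  refine ⟨k, ?_⟩
  rw [← QuotientGroup.eq_one_iff]
  exact congrArg Subtype.val hk

lemma sq_formula (M : SL2R) : (M : Matrix (Fin 2) (Fin 2) ℝ) * M =
    (M 0 0 + M 1 1) • (M : Matrix (Fin 2) (Fin 2) ℝ) - 1 := by
  have hA := det_eq M
  ext i j
  fin_cases i <;> fin_cases j <;>
    simp [Matrix.mul_apply, Fin.sum_univ_two] <;> first | ring1 | linear_combination -hA

lemma scalar_center {M : SL2R} {c : ℝ} (h : (M : Matrix (Fin 2) (Fin 2) ℝ) = c • 1) :
    M = 1 ∨ M = -1 := by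
  have h0 := congrFun (congrFun h 0) 0
  have h1 := congrFun (congrFun h 0) 1
  have h2 := congrFun (congrFun h 1) 0
  have h3 := congrFun (congrFun h 1) 1
  simp at h0 h1 h2 h3
  have hd := det_eq M
  rw [h0, h1, h3] at hd
  have : (c-1)*(c+1) = 0 := by linear_combination hd
  rcases mul_eq_zero.1 this with h | h
  · left; apply sl_ext <;> simp [h0, h1, h2, h3] <;> linarith
  · right; apply sl_ext <;> simp [h0, h1, h2, h3] <;> linarith

lemma tr_order_two {M : SL2R} (h : (M : PSL2R)^2 = 1) (h1 : (M : PSL2R) ≠ 1) :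
    M 0 0 + M 1 1 = 0 := by
  by_contra h0
  apply h1
  rw [mk_eq_one]
  rw [← QuotientGroup.mk_pow, mk_eq_one] at h
  have hsq := sq_formula M
  set t := M 0 0 + M 1 1
  obtain ⟨e, he⟩ : ∃ e : ℝ, (M : Matrix (Fin 2) (Fin 2) ℝ) * M = e • 1 := by
    rw [← Matrix.SpecialLinearGroup.coe_mul, ← pow_two]
    rcases h with h | h
    · exact ⟨1, by rw [h]; simp⟩
    · exact ⟨-1, by rw [h]; simp⟩
  apply scalar_center (c := t⁻¹ * (e+1))
  rw [mul_smul, add_smul, ← he, hsq, one_smul, sub_add_cancel, inv_smul_smul₀ h0]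

lemma tr_order_three {M : SL2R} (h : (M : PSL2R)^3 = 1) (h1 : (M : PSL2R) ≠ 1) :
    M 0 0 + M 1 1 = 1 ∨ M 0 0 + M 1 1 = -1 := by
  have hh : (M 0 0 + M 1 1)^2 - 1 = 0 := by
    by_contra h0
    apply h1
    rw [mk_eq_one]
    rw [← QuotientGroup.mk_pow, mk_eq_one] at h
    have hsq := sq_formula M
    set t := M 0 0 + M 1 1
    obtain ⟨e, he⟩ : ∃ e : ℝ, (M : Matrix (Fin 2) (Fin 2) ℝ) * M * M = e • 1 := by
      rw [← Matrix.SpecialLinearGroup.coe_mul, ← pow_two, ← Matrix.SpecialLinearGroup.coe_mul,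
        ← pow_succ]
      rcases h with h | h
      · exact ⟨1, by rw [h]; simp⟩
      · exact ⟨-1, by rw [h]; simp⟩
    apply scalar_center (c := (t^2-1)⁻¹ * (e+t))
    have : (M : Matrix (Fin 2) (Fin 2) ℝ) * M * M = (t^2-1) • (M : Matrix (Fin 2) (Fin 2) ℝ) - t • 1 := by
      rw [hsq, sub_mul, smul_mul_assoc, hsq, one_mul]; module
    rw [mul_smul, add_smul, ← he, this, sub_add_cancel, inv_smul_smul₀ h0]
  have : (M 0 0 + M 1 1 - 1) * (M 0 0 + M 1 1 + 1) = 0 := by linear_combination hh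
  rcases mul_eq_zero.1 this with h | h
  · left; linarith
  · right; linarith

lemma tr_finite_aux {M : SL2R} {k : ℕ} (hk : 0 < k) (h : M ^ k = 1) (h1 : M ≠ 1)
    (ht : 2 ≤ M 0 0 + M 1 1) : False := by
  have hsq := sq_formula M
  rcases ht.eq_or_lt with he | hlt
  · rw [← he] at hsq
    have hpow : ∀ j : ℕ, ((M^j : SL2R) : Matrix (Fin 2) (Fin 2) ℝ) =
        (j:ℝ) • (M : Matrix (Fin 2) (Fin 2) ℝ) - ((j:ℝ)-1) • 1 := by
      intro j
      induction j with
      | zero => simp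
      | succ j ih =>
        rw [pow_succ, Matrix.SpecialLinearGroup.coe_mul, ih, sub_mul, smul_mul_assoc, hsq,
          smul_mul_assoc, one_mul]
        push_cast; module
    have h2 := hpow k
    rw [h] at h2
    apply h1
    have hk' : (k:ℝ) ≠ 0 := by exact_mod_cast hk.ne'
    apply Subtype.ext
    have : (k:ℝ) • (M : Matrix (Fin 2) (Fin 2) ℝ) = (k:ℝ) • 1 := by
      rw [Matrix.SpecialLinearGroup.coe_one] at h2
      rw [eq_sub_iff_add_eq] at h2
      rw [← h2]; module
    exact smul_right_injective _ hk' this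
  · obtain ⟨l, hl1, hl⟩ := exists_lam hlt
    have hf := zpow_formula M l (by positivity) hl.symm k
    rw [zpow_natCast, h, Matrix.SpecialLinearGroup.coe_one] at hf
    have hne : l ^ (k:ℤ) - l ^ (-(k:ℤ)) ≠ 0 := by
      have h1 : 1 < l ^ (k:ℤ) := one_lt_zpow₀ hl1 (by omega)
      have h2 : l ^ (-(k:ℤ)) < 1 := zpow_lt_one_of_neg₀ hl1 (by omega)
      linarith
    set s := l ^ (k:ℤ) - l ^ (-(k:ℤ))
    set s' := l ^ ((k:ℤ)-1) - l ^ (1-(k:ℤ))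
    have : M = 1 ∨ M = -1 := by
      apply scalar_center (c := s⁻¹ * (l - l⁻¹ + s'))
      rw [mul_smul, add_smul, hf, sub_add_cancel, inv_smul_smul₀ hne]
    rcases this with h | h
    · exact h1 h
    · rw [h] at ht; simp at ht; norm_num at ht

lemma tr_finite {M : SL2R} {k : ℕ} (hk : 0 < k) (h : (M : PSL2R) ^ k = 1) (h1 : (M : PSL2R) ≠ 1) :
    (M 0 0 + M 1 1)^2 < 4 := by
  rw [← QuotientGroup.mk_pow, mk_eq_one] at h
  have h2 : M ^ (2*k) = 1 := by
    rw [mul_comm, pow_mul]; rcases h with h | h <;> rw [h] <;> simp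
  by_contra! hge
  rw [Ne, mk_eq_one, not_or] at h1
  rcases le_or_gt 0 (M 0 0 + M 1 1) with h0 | h0
  · exact tr_finite_aux (by omega) h2 h1.1 (by nlinarith)
  · refine tr_finite_aux (M := -M) (k := 2*k) (by omega) ?_ ?_ ?_
    · rw [Even.neg_pow (even_two_mul k), h2]
    · intro h; exact h1.2 (by rw [← h, neg_neg])
    · simp only [Matrix.SpecialLinearGroup.coe_neg, Matrix.neg_apply]; nlinarith

lemma cube {M : SL2R} (h : M 0 0 + M 1 1 = 1) : (M : PSL2R)^3 = 1 := by
  rw [← QuotientGroup.mk_pow, mk_eq_one]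
  right
  have hsq := sq_formula M
  rw [h] at hsq
  apply Subtype.ext
  rw [pow_succ, pow_two, Matrix.SpecialLinearGroup.coe_mul, Matrix.SpecialLinearGroup.coe_mul,
    hsq, sub_mul, smul_mul_assoc, hsq]
  simp

end HPt
end

noncomputable section
namespace HPt

/-- The geometric data extracted from the representation. -/
structure Geo (Δ : Subgroup PSL2R) where
  P : HPt
  m : ℕ
  a : Δ
  b : Δ
  g : Δ
  hm : 2 ≤ m
  ha : (a : PSL2R) = (P.rot (Real.pi / m) : SL2R)
  hgen : Subgroup.closure {a, b} = ⊤
  hconj : b = g * a * g⁻¹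
  hcube : (a * b) ^ 3 = 1
  htors : ∀ x : Δ, 4 ≤ orderOf x → ∃ (h : Δ) (i : ℤ), x = h * a ^ i * h⁻¹

lemma mk_rot_int_pi (P : HPt) (α : ℝ) (j : ℤ) :
    ((P.rot (α + j * Real.pi) : SL2R) : PSL2R) = (P.rot α : SL2R) := by
  rw [rot_add, QuotientGroup.mk_mul,
    (QuotientGroup.eq_one_iff (P.rot (j * Real.pi))).2 ((rot_mem_center P _).2 (Real.sin_int_mul_pi j)),
    mul_one]

lemma twist_aux {G : Type*} [Group G] (n : ℤ) (f : FreeGroup (Fin 2) →* G)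
    (h : f (twistRel n) = 1) :
    f (FreeGroup.of 0) * (f (FreeGroup.of 0) * (f (FreeGroup.of 1))⁻¹ * (f (FreeGroup.of 0))⁻¹ *
      f (FreeGroup.of 1)) ^ n = (f (FreeGroup.of 0) * (f (FreeGroup.of 1))⁻¹ *
      (f (FreeGroup.of 0))⁻¹ * f (FreeGroup.of 1)) ^ n * f (FreeGroup.of 1) := by
  rw [twistRel] at h
  simp only [map_mul, map_inv, map_zpow] at h
  exact mul_inv_eq_one.1 h

theorem geo (n : ℤ) (Δ : Subgroup PSL2R) (hdisc : DiscreteTopology ↥Δ)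
    (hnab : ∃ x y : Δ, x * y ≠ y * x)
    (ρ : TwistKnotGroup n →* ↥Δ) (hsurj : Function.Surjective ρ)
    (hell : IsElliptic ((ρ (PresentedGroup.of 0) : PSL2R))) :
    n = 1 ∧ Nonempty (Geo Δ) := by
  have hD := disc_pre Δ hdisc
  have hneg := neg_one_mem_pre Δ
  set a := ρ (PresentedGroup.of 0) with ha
  set b := ρ (PresentedGroup.of 1) with hb
  have hgen : Subgroup.closure {a, b} = (⊤ : Subgroup Δ) := by
    have h1 := PresentedGroup.closure_range_of ({twistRel n} : Set (FreeGroup (Fin 2)))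
    have h2 := congrArg (Subgroup.map ρ) h1
    rw [MonoidHom.map_closure, ← MonoidHom.range_eq_map, MonoidHom.range_eq_top.2 hsurj] at h2
    rw [← h2]; congr 1
    ext x
    simp only [Set.mem_insert_iff, Set.mem_singleton_iff, Set.mem_image, Set.mem_range]
    constructor
    · rintro (h | h)
      · exact ⟨_, ⟨0, rfl⟩, h.symm⟩
      · exact ⟨_, ⟨1, rfl⟩, h.symm⟩
    · rintro ⟨y, ⟨i, rfl⟩, rfl⟩
      fin_cases i
      · left; rfl
      · right; rfl
  have hrel0 : a * (a * b⁻¹ * a⁻¹ * b) ^ n = (a * b⁻¹ * a⁻¹ * b) ^ n * b := by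
    have h1 : PresentedGroup.mk ({twistRel n} : Set (FreeGroup (Fin 2))) (twistRel n) = 1 :=
      PresentedGroup.one_of_mem (Set.mem_singleton _)
    have h2 := congrArg ρ h1
    rw [map_one] at h2
    exact twist_aux n (ρ.comp (PresentedGroup.mk ({twistRel n} : Set (FreeGroup (Fin 2))))) h2
  -- lifts
  set A : SL2R := Quotient.out (a : PSL2R) with hA
  have hAa : (A : PSL2R) = a := Quotient.out_eq _
  have htrA : (A 0 0 + A 1 1)^2 < 4 := by
    have := hell.2
    rw [tr2R, Matrix.trace_fin_two] at this
    exact this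
  obtain ⟨P, θ, hAP⟩ := exists_rot A htrA
  have hs : Real.sin θ ≠ 0 := by
    intro h0
    apply hell.1
    rw [← hAa, hAP]
    exact (QuotientGroup.eq_one_iff _).2 ((rot_mem_center P θ).2 h0)
  obtain ⟨B, hBb, hAB⟩ : ∃ B : SL2R, (B : PSL2R) = b ∧
      A * (A * B⁻¹ * A⁻¹ * B) ^ n = (A * B⁻¹ * A⁻¹ * B) ^ n * B := by
    obtain ⟨B0, hB0⟩ := QuotientGroup.mk_surjective (b : PSL2R)
    have h1 : ((A * (A * B0⁻¹ * A⁻¹ * B0) ^ n : SL2R) : PSL2R) =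
        (((A * B0⁻¹ * A⁻¹ * B0) ^ n * B0 : SL2R) : PSL2R) := by
      simp only [QuotientGroup.mk_mul, QuotientGroup.mk_inv, QuotientGroup.mk_zpow, hAa, hB0]
      exact_mod_cast congrArg Subtype.val hrel0
    rw [mk_eq] at h1
    rcases h1 with h | h
    · exact ⟨B0, hB0, h⟩
    · refine ⟨-B0, ?_, ?_⟩
      · rw [← hB0, mk_eq]; right; rfl
      · have e : (-B0)⁻¹ = -B0⁻¹ := by
          rw [inv_eq_iff_mul_eq_one]; simp
        rw [e]
        simp only [mul_neg, neg_mul, neg_neg]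
        exact h
  have hAΓ : A ∈ pre Δ := by rw [mem_pre, hAa]; exact a.2
  have hBΓ : B ∈ pre Δ := by rw [mem_pre, hBb]; exact b.2
  set W := A * B⁻¹ * A⁻¹ * B with hW
  have hWΓ : W ∈ pre Δ :=
    Subgroup.mul_mem _ (Subgroup.mul_mem _ (Subgroup.mul_mem _ hAΓ (Subgroup.inv_mem _ hBΓ))
      (Subgroup.inv_mem _ hAΓ)) hBΓ
  set w := (W ^ n)⁻¹ with hw
  have hwΓ : w ∈ pre Δ := Subgroup.inv_mem _ (Subgroup.zpow_mem _ hWΓ n)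
  have hBw : B = w * A * w⁻¹ := by
    rw [hw, inv_inv, mul_assoc, hAB, inv_mul_cancel_left]
  obtain ⟨Q, hQ⟩ : ∃ Q, Q = act w P := ⟨_, rfl⟩
  have hBQ : B = Q.rot θ := by rw [hBw, hAP, conj_rot, hQ]
  have hPQ : P ≠ Q := by
    intro h
    have hab : a = b := by
      apply Subtype.ext
      rw [← hAa, ← hBb, hAP, hBQ, h]
    obtain ⟨x, y, hxy⟩ := hnab
    apply hxy
    rw [← hab, Set.pair_eq_singleton, ← Subgroup.zpowers_eq_closure] at hgen
    have hx : x ∈ Subgroup.zpowers a := by rw [hgen]; trivial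
    have hy : y ∈ Subgroup.zpowers a := by rw [hgen]; trivial
    obtain ⟨i, rfl⟩ := hx
    obtain ⟨j, rfl⟩ := hy
    exact (Commute.zpow_zpow_self a i j)
  rw [hW, hAP, hBQ] at hAB
  rw [hAP] at hAΓ
  rw [hBQ] at hBΓ
  obtain ⟨hn, hv⟩ := stepB hD hs hAΓ hBΓ hPQ hAB
  refine ⟨hn, ?_⟩
  obtain ⟨m, hm1, hm⟩ := exists_order hD hneg P
  obtain ⟨hm2, hv', j, hj⟩ := stepC hD hs hAΓ hwΓ hQ hPQ hv hm1 hm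
  have hPm : P.rot (Real.pi / m) ∈ pre Δ := (hm _).2 ⟨1, by simp⟩
  have hcub : (a * b)^3 = 1 := by
    apply Subtype.ext
    push_cast
    rw [← hAa, ← hBb, ← QuotientGroup.mk_mul]
    apply cube
    rw [hAP, hBQ, trace_rot_mul]
    have := Real.sin_sq_add_cos_sq θ
    linarith
  set g : Δ := ⟨(w : PSL2R), hwΓ⟩ with hg
  have hconj : b = g * a * g⁻¹ := by
    apply Subtype.ext
    push_cast
    rw [← hAa, ← hBb, hBw]
    rfl
  set a0 : Δ := ⟨(P.rot (Real.pi / m) : SL2R), hPm⟩ with ha0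
  have htors : ∀ x : Δ, 4 ≤ orderOf x → ∃ (h : Δ) (i : ℤ), x = h * a0 ^ i * h⁻¹ := by
    intro x hx
    obtain ⟨M, hM⟩ := QuotientGroup.mk_surjective (x : PSL2R)
    have hx1 : (M : PSL2R) ≠ 1 := by
      intro h
      have : x = 1 := Subtype.ext (by rw [← hM, h]; rfl)
      rw [this, orderOf_one] at hx; omega
    have hxk : (M : PSL2R) ^ (orderOf x) = 1 := by
      rw [hM]; exact_mod_cast congrArg Subtype.val (pow_orderOf_eq_one x)
    obtain ⟨R, φ, hR⟩ := exists_rot M (tr_finite (by omega) hxk hx1)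
    have hMΓ : M ∈ pre Δ := by rw [mem_pre, hM]; exact x.2
    obtain ⟨k, hk1, hk⟩ := exists_order hD hneg R
    obtain ⟨i, hi⟩ := (hk φ).1 (hR ▸ hMΓ)
    have hk0 : (k:ℝ) ≠ 0 := by exact_mod_cast (by omega : k ≠ 0)
    have hdvd : orderOf x ∣ k := by
      apply orderOf_dvd_of_pow_eq_one
      apply Subtype.ext
      push_cast
      rw [← hM, hR, ← QuotientGroup.mk_pow, ← rot_nat, hi]
      apply (QuotientGroup.eq_one_iff _).2 ((rot_mem_center R _).2 _)
      have : (k:ℝ) * (i * (Real.pi / k)) = i * Real.pi := by field_simp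
      rw [this, Real.sin_int_mul_pi]
    have hk4 : 4 ≤ k := hx.trans (Nat.le_of_dvd (by omega) hdvd)
    obtain ⟨h, hhΓ, hh⟩ := stepD hD hwΓ hQ hPQ hm2 hPm hv' hk4 ((hk _).2 ⟨1, by simp⟩)
    have hPφ : P.rot φ ∈ pre Δ := by
      have e : P.rot φ = h⁻¹ * R.rot φ * h⁻¹⁻¹ := by
        rw [hh, ← conj_rot]; group
      rw [e, ← hR]
      exact Subgroup.mul_mem _ (Subgroup.mul_mem _ (Subgroup.inv_mem _ hhΓ) hMΓ)
        (Subgroup.inv_mem _ (Subgroup.inv_mem _ hhΓ))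
    obtain ⟨i', hi'⟩ := (hm φ).1 hPφ
    refine ⟨⟨(h : PSL2R), hhΓ⟩, i', ?_⟩
    apply Subtype.ext
    push_cast
    rw [← hM, hR, hh, ← conj_rot, hi', rot_int]
    rfl
  rcases hj with hj | hj
  · have e : a = a0 := by
      apply Subtype.ext
      rw [← hAa, hAP, hj, mk_rot_int_pi]
    rw [← e] at htors
    exact ⟨⟨P, m, a, b, g, hm2, by rw [e], hgen, hconj, hcub, htors⟩⟩
  · have e : a⁻¹ = a0 := by
      apply Subtype.ext
      push_cast
      rw [← hAa, hAP, hj, mk_rot_int_pi, rot_neg, QuotientGroup.mk_inv, inv_inv]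
    rw [← e] at htors
    refine ⟨⟨P, m, a⁻¹, b⁻¹, g, hm2, by rw [e], ?_, ?_, ?_, htors⟩⟩
    · rw [eq_top_iff, ← hgen, Subgroup.closure_le]
      intro x hx
      rcases hx with rfl | hx
      · exact (Subgroup.inv_mem_iff _).1 (Subgroup.subset_closure (by simp))
      · rw [Set.mem_singleton_iff] at hx
        subst hx
        exact (Subgroup.inv_mem_iff _).1 (Subgroup.subset_closure (by simp))
    · rw [hconj]; group
    · have : a⁻¹ * b⁻¹ = a⁻¹ * (a * b)⁻¹ * a := by group
      have h2 : (a⁻¹ * (a * b)⁻¹ * a⁻¹⁻¹) ^ 3 = a⁻¹ * ((a * b)⁻¹)^3 * a⁻¹⁻¹ := conj_pow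
      rw [inv_inv] at h2
      rw [this, h2, inv_pow, hcub]; simp

end HPt
end

noncomputable section

/-- `D` is the `(p,q,r)`-triangle group, with generators `X`, `Y`, `Z`. -/
structure IsTri {D : Type} [Group D] (p q r : ℕ) (X Y Z : D) : Prop where
  hX : X ^ p = 1
  hY : Y ^ q = 1
  hZ : Z ^ r = 1
  hXYZ : X * Y * Z = 1
  gen : Subgroup.closure {X, Y, Z} = ⊤
  univ : ∀ (H : Type) [Group H] (x y z : H), x ^ p = 1 → y ^ q = 1 → z ^ r = 1 → x * y * z = 1 →
    ∃ f : D →* H, f X = x ∧ f Y = y ∧ f Z = z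

namespace IsTri

variable {D : Type} [Group D] {p q r : ℕ} {X Y Z : D}

lemma rotate (h : IsTri p q r X Y Z) : IsTri q r p Y Z X where
  hX := h.hY
  hY := h.hZ
  hZ := h.hX
  hXYZ := by
    have e : Y * Z * X = X⁻¹ * (X * Y * Z) * X := by group
    rw [e, h.hXYZ]; simp
  gen := by
    rw [← h.gen]; congr 1; ext; simp; tauto
  univ := fun H _ x y z hx hy hz hxyz => by
    obtain ⟨f, h1, h2, h3⟩ := h.univ H z x y hz hx hy (by
      have e : z * x * y = z * (x * y * z) * z⁻¹ := by group
      rw [e, hxyz]; simp)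
    exact ⟨f, h2, h3, h1⟩

lemma reverse (h : IsTri p q r X Y Z) : IsTri r q p Z⁻¹ Y⁻¹ X⁻¹ where
  hX := by rw [inv_pow, h.hZ, inv_one]
  hY := by rw [inv_pow, h.hY, inv_one]
  hZ := by rw [inv_pow, h.hX, inv_one]
  hXYZ := by
    have e : Z⁻¹ * Y⁻¹ * X⁻¹ = (X * Y * Z)⁻¹ := by group
    rw [e, h.hXYZ, inv_one]
  gen := by
    rw [eq_top_iff, ← h.gen, Subgroup.closure_le]
    rintro x (rfl | rfl | rfl) <;>
    exact (Subgroup.inv_mem_iff _).1 (Subgroup.subset_closure (by simp))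
  univ := fun H _ x y z hx hy hz hxyz => by
    obtain ⟨f, h1, h2, h3⟩ := h.univ H z⁻¹ y⁻¹ x⁻¹ (by rw [inv_pow, hz, inv_one])
      (by rw [inv_pow, hy, inv_one]) (by rw [inv_pow, hx, inv_one]) (by
      have e : z⁻¹ * y⁻¹ * x⁻¹ = (x * y * z)⁻¹ := by group
      rw [e, hxyz, inv_one])
    exact ⟨f, by rw [map_inv, h3, inv_inv], by rw [map_inv, h2, inv_inv], by rw [map_inv, h1, inv_inv]⟩

lemma gen2 (h : IsTri p q r X Y Z) : Subgroup.closure {X, Y} = (⊤ : Subgroup D) := by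
  rw [eq_top_iff, ← h.gen, Subgroup.closure_le]
  have hX : X ∈ Subgroup.closure {X, Y} := Subgroup.subset_closure (by simp)
  have hY : Y ∈ Subgroup.closure {X, Y} := Subgroup.subset_closure (by simp)
  rintro x (hx | hx | hx)
  · rw [hx]; exact hX
  · rw [hx]; exact hY
  · rw [Set.mem_singleton_iff] at hx
    have e : Z = (X * Y)⁻¹ := (inv_eq_of_mul_eq_one_right h.hXYZ).symm
    rw [hx, e]
    exact Subgroup.inv_mem _ (Subgroup.mul_mem _ hX hY)

end IsTri

/-- `SL(2,ℂ)`. -/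
abbrev SL2C : Type := Matrix.SpecialLinearGroup (Fin 2) ℂ

lemma slc_scalar {M : SL2C} : M ∈ Subgroup.center SL2C ↔
    ∃ c : ℂ, (M : Matrix (Fin 2) (Fin 2) ℂ) = c • 1 := by
  rw [Matrix.SpecialLinearGroup.mem_center_iff]
  constructor
  · rintro ⟨c, h1, h2⟩
    exact ⟨c, by rw [← h2]; ext i j; simp [Matrix.scalar_apply, Matrix.diagonal_apply, Matrix.one_apply]⟩
  · rintro ⟨c, hc⟩
    refine ⟨c, ?_, ?_⟩
    · have := M.det_coe
      rw [hc, Matrix.det_smul, Matrix.det_one, mul_one] at this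
      exact this
    · rw [hc]; ext i j; simp [Matrix.scalar_apply, Matrix.diagonal_apply, Matrix.one_apply]

lemma slc_not_scalar {M : SL2C} {l : ℂ} (hl : l ≠ 0) (hl2 : l^2 ≠ 1)
    (ht : M 0 0 + M 1 1 = l + l⁻¹) (c : ℂ) : (M : Matrix (Fin 2) (Fin 2) ℂ) ≠ c • 1 := by
  intro h
  have hd := M.det_coe
  rw [h, Matrix.det_smul, Matrix.det_one, mul_one, Fintype.card_fin] at hd
  rw [h] at ht
  simp at ht
  have h1 : (l - c)^2 = 0 := by
    have : l^2 + 1 = (c + c) * l := by rw [ht]; field_simp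
    linear_combination this + hd
  have h2 : l = c := sub_eq_zero.1 (pow_eq_zero_iff two_ne_zero |>.1 h1)
  exact hl2 (by rw [h2, hd])

lemma eq_inv_iff_mul_eq_one₀' {x y : ℂ} (hy : y ≠ 0) : x = y⁻¹ ↔ x * y = 1 := by
  rw [eq_comm, inv_eq_iff_eq_inv, eq_comm, inv_eq_iff_eq_inv]
  exact ⟨fun h => by rw [h, inv_mul_cancel₀ hy], fun h => eq_inv_of_mul_eq_one_left h⟩

lemma psl_pow {M : SL2C} {l : ℂ} (hl : l ≠ 0) (hl2 : l^2 ≠ 1)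
    (ht : M 0 0 + M 1 1 = l + l⁻¹) (k : ℕ) :
    ((M : SL2C ⧸ Subgroup.center SL2C) ^ k = 1 ↔ l ^ (2*k) = 1) := by
  rw [← QuotientGroup.mk_pow, QuotientGroup.eq_one_iff, slc_scalar]
  have hf := HPt.zpow_formula M l hl ht k
  rw [zpow_natCast] at hf
  have hll : l - l⁻¹ ≠ 0 := by
    intro h
    apply hl2
    field_simp at h
    linear_combination h
  have hs : l ^ (k:ℤ) - l ^ (-(k:ℤ)) = 0 ↔ l ^ (2*k) = 1 := by
    rw [zpow_neg, zpow_natCast, two_mul, pow_add, sub_eq_zero,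
      eq_inv_iff_mul_eq_one₀' (pow_ne_zero _ hl)]
  rw [← hs]
  generalize l ^ (k:ℤ) - l ^ (-(k:ℤ)) = s at *
  generalize l ^ ((k:ℤ)-1) - l ^ (1-(k:ℤ)) = s' at *
  constructor
  · rintro ⟨c, hc⟩
    by_contra hne
    apply slc_not_scalar hl hl2 ht (s⁻¹ * ((l - l⁻¹) * c + s'))
    rw [hc] at hf
    rw [mul_smul, add_smul, mul_smul, hf, sub_add_cancel, inv_smul_smul₀ hne]
  · intro h
    refine ⟨(l - l⁻¹)⁻¹ * (-s'), ?_⟩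
    rw [h, zero_smul, zero_sub, ← neg_smul] at hf
    rw [mul_smul, ← hf, inv_smul_smul₀ hll]

lemma exists_eig {p α : ℕ} (h0 : 0 < α) (h1 : α < p) : ∃ l : ℂ, l ≠ 0 ∧ l^2 ≠ 1 ∧
    ∀ k : ℕ, l ^ (2*k) = 1 ↔ p ∣ α * k := by
  have hz := Complex.isPrimitiveRoot_exp (2*p) (by omega)
  set ζ := Complex.exp (2 * Real.pi * Complex.I / ((2*p : ℕ) : ℂ))
  have key : ∀ k : ℕ, (ζ^α) ^ (2*k) = 1 ↔ p ∣ α * k := by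
    intro k
    rw [← pow_mul, hz.pow_eq_one_iff_dvd, show α * (2*k) = 2 * (α * k) by ring]
    exact Nat.mul_dvd_mul_iff_left (by norm_num)
  refine ⟨ζ^α, pow_ne_zero _ (hz.ne_zero (by omega)), ?_, key⟩
  have := key 1
  rw [mul_one, mul_one] at this
  rw [Ne, this]
  exact Nat.not_dvd_of_pos_of_lt h0 h1

theorem IsTri.rep {D : Type} [Group D] {p q r : ℕ} {X Y Z : D} (h : IsTri p q r X Y Z)
    {α β γ : ℕ} (hα : 0 < α) (hα' : α < p) (hβ : 0 < β) (hβ' : β < q) (hγ : 0 < γ) (hγ' : γ < r) :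
    ∃ σ : D →* (SL2C ⧸ Subgroup.center SL2C),
      (∀ k : ℕ, σ X ^ k = 1 ↔ p ∣ α * k) ∧ (∀ k : ℕ, σ Y ^ k = 1 ↔ q ∣ β * k) ∧
      (∀ k : ℕ, σ Z ^ k = 1 ↔ r ∣ γ * k) ∧ (σ X * σ Y = σ Y * σ X → q ∣ β * 2) := by
  obtain ⟨x, hx0, hx1, hx⟩ := exists_eig hα hα'
  obtain ⟨y, hy0, hy1, hy⟩ := exists_eig hβ hβ'
  obtain ⟨z, hz0, hz1, hz⟩ := exists_eig hγ hγ'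
  set t := z + z⁻¹ - x * y - x⁻¹ * y⁻¹ with ht
  let A : SL2C := ⟨!![x, 1; 0, x⁻¹], by rw [Matrix.det_fin_two_of]; field_simp; simp⟩
  let B : SL2C := ⟨!![y, 0; t, y⁻¹], by rw [Matrix.det_fin_two_of]; field_simp; simp⟩
  have hA00 : A 0 0 = x := rfl
  have hA01 : A 0 1 = 1 := rfl
  have hA10 : A 1 0 = 0 := rfl
  have hA11 : A 1 1 = x⁻¹ := rfl
  have hB00 : B 0 0 = y := rfl
  have hB01 : B 0 1 = 0 := rfl
  have hB10 : B 1 0 = t := rfl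
  have hB11 : B 1 1 = y⁻¹ := rfl
  clear_value A B
  have hA : A 0 0 + A 1 1 = x + x⁻¹ := by rw [hA00, hA11]
  have hB : B 0 0 + B 1 1 = y + y⁻¹ := by rw [hB00, hB11]
  have hAB : (A * B)⁻¹ 0 0 + (A * B)⁻¹ 1 1 = z + z⁻¹ := by
    rw [Matrix.SpecialLinearGroup.coe_inv, Matrix.adjugate_fin_two]
    simp [Matrix.mul_apply, Fin.sum_univ_two, hA00, hA01, hA10, hA11, hB00, hB01, hB10, hB11, ht]
    try ring
  obtain ⟨σ, h1, h2, h3⟩ := h.univ (SL2C ⧸ Subgroup.center SL2C) (A : SL2C ⧸ Subgroup.center SL2C)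
    (B : SL2C ⧸ Subgroup.center SL2C) (((A * B)⁻¹ : SL2C) : SL2C ⧸ Subgroup.center SL2C)
    ((psl_pow hx0 hx1 hA p).2 ((hx p).2 (Dvd.intro_left α rfl)))
    ((psl_pow hy0 hy1 hB q).2 ((hy q).2 (Dvd.intro_left β rfl)))
    ((psl_pow hz0 hz1 hAB r).2 ((hz r).2 (Dvd.intro_left γ rfl)))
    (by rw [QuotientGroup.mk_inv, QuotientGroup.mk_mul, mul_inv_cancel])
  refine ⟨σ, fun k => ?_, fun k => ?_, fun k => ?_, ?_⟩
  · rw [h1, psl_pow hx0 hx1 hA, hx]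
  · rw [h2, psl_pow hy0 hy1 hB, hy]
  · rw [h3, psl_pow hz0 hz1 hAB, hz]
  · intro hc
    rw [h1, h2, ← QuotientGroup.mk_mul, ← QuotientGroup.mk_mul, QuotientGroup.eq, slc_scalar] at hc
    obtain ⟨c, hc⟩ := hc
    have hd := ((A * B)⁻¹ * (B * A)).det_coe
    rw [hc, Matrix.det_smul, Matrix.det_one, mul_one, Fintype.card_fin] at hd
    have h4 : ((B * A : SL2C) : Matrix (Fin 2) (Fin 2) ℂ) = c • ((A * B : SL2C) : Matrix (Fin 2) (Fin 2) ℂ) := by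
      have : B * A = (A * B) * ((A * B)⁻¹ * (B * A)) := by group
      rw [this, Matrix.SpecialLinearGroup.coe_mul (A * B), hc, mul_smul_comm, mul_one]
    have h5 := congrFun (congrFun h4 0) 1
    simp [Matrix.mul_apply, Fin.sum_univ_two, hA00, hA01, hA10, hA11, hB00, hB01, hB10, hB11] at h5
    rw [← hy 2]
    have h6 : y * y = c := by
      field_simp at h5; linear_combination h5
    calc y ^ (2*2) = (y*y)^2 := by ring
      _ = 1 := by rw [h6, hd]

theorem IsTri.orders {D : Type} [Group D] {p q r : ℕ} {X Y Z : D} (h : IsTri p q r X Y Z)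
    (hp : 2 ≤ p) (hq : 2 ≤ q) (hr : 2 ≤ r) : orderOf X = p ∧ orderOf Y = q ∧ orderOf Z = r := by
  obtain ⟨σ, h1, h2, h3, -⟩ := h.rep (α := 1) (β := 1) (γ := 1) one_pos (by omega) one_pos
    (by omega) one_pos (by omega)
  refine ⟨?_, ?_, ?_⟩
  · apply Nat.dvd_antisymm (orderOf_dvd_of_pow_eq_one h.hX)
    have := (h1 (orderOf X)).1 (by rw [← map_pow, pow_orderOf_eq_one, map_one])
    rwa [one_mul] at this
  · apply Nat.dvd_antisymm (orderOf_dvd_of_pow_eq_one h.hY)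
    have := (h2 (orderOf Y)).1 (by rw [← map_pow, pow_orderOf_eq_one, map_one])
    rwa [one_mul] at this
  · apply Nat.dvd_antisymm (orderOf_dvd_of_pow_eq_one h.hZ)
    have := (h3 (orderOf Z)).1 (by rw [← map_pow, pow_orderOf_eq_one, map_one])
    rwa [one_mul] at this

theorem IsTri.nonab {D : Type} [Group D] {p q r : ℕ} {X Y Z : D} (h : IsTri p q r X Y Z)
    (hp : 2 ≤ p) (hq : 3 ≤ q) (hr : 2 ≤ r) : ∃ x y : D, x * y ≠ y * x := by
  obtain ⟨σ, -, -, -, h4⟩ := h.rep (α := 1) (β := 1) (γ := 1) one_pos (by omega) one_pos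
    (by omega) one_pos (by omega)
  refine ⟨X, Y, fun hc => ?_⟩
  have := Nat.le_of_dvd (by norm_num) (h4 (by rw [← map_mul, hc, map_mul]))
  omega

lemma isTri_presented (p q r : ℕ) : IsTri (D := TriangleGroup p q r) p q r
    (PresentedGroup.of 0) (PresentedGroup.of 1) (PresentedGroup.of 2) where
  hX := PresentedGroup.one_of_mem (rels := triangleRels3 p q r) (x := FreeGroup.of 0 ^ p)
    (by simp [triangleRels3])
  hY := PresentedGroup.one_of_mem (rels := triangleRels3 p q r) (x := FreeGroup.of 1 ^ q)
    (by simp [triangleRels3])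
  hZ := PresentedGroup.one_of_mem (rels := triangleRels3 p q r) (x := FreeGroup.of 2 ^ r)
    (by simp [triangleRels3])
  hXYZ := PresentedGroup.one_of_mem (rels := triangleRels3 p q r)
    (x := FreeGroup.of 0 * FreeGroup.of 1 * FreeGroup.of 2) (by simp [triangleRels3])
  gen := by
    rw [← PresentedGroup.closure_range_of]
    congr 1
    ext x
    simp only [Set.mem_insert_iff, Set.mem_singleton_iff, Set.mem_range]
    constructor
    · rintro (h | h | h)
      · exact ⟨0, h.symm⟩
      · exact ⟨1, h.symm⟩
      · exact ⟨2, h.symm⟩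
    · rintro ⟨i, rfl⟩
      fin_cases i
      · left; rfl
      · right; left; rfl
      · right; right; rfl
  univ := fun H _ x y z hx hy hz hxyz => by
    have hrel : ∀ w ∈ triangleRels3 p q r, FreeGroup.lift ![x, y, z] w = 1 := by
      rintro w (rfl | rfl | rfl | hw)
      · simpa using hx
      · simpa using hy
      · simpa using hz
      · rw [Set.mem_singleton_iff] at hw
        subst hw; simpa using hxyz
    refine ⟨PresentedGroup.toGroup hrel, ?_, ?_, ?_⟩ <;> rw [PresentedGroup.toGroup.of] <;> rfl

lemma isTri_transport {D E : Type} [Group D] [Group E] (e : D ≃* E) {p q r : ℕ} {X Y Z : E}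
    (h : IsTri p q r X Y Z) : IsTri p q r (e.symm X) (e.symm Y) (e.symm Z) where
  hX := by rw [← map_pow, h.hX, map_one]
  hY := by rw [← map_pow, h.hY, map_one]
  hZ := by rw [← map_pow, h.hZ, map_one]
  hXYZ := by rw [← map_mul, ← map_mul, h.hXYZ, map_one]
  gen := by
    have h2 := congrArg (Subgroup.map e.symm.toMonoidHom) h.gen
    rw [MonoidHom.map_closure, ← MonoidHom.range_eq_map, MonoidHom.range_eq_top.2 e.symm.surjective] at h2
    rw [← h2, Set.image_insert_eq, Set.image_insert_eq, Set.image_singleton]; rfl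
  univ := fun H _ x y z hx hy hz hxyz => by
    obtain ⟨f, h1, h2, h3⟩ := h.univ H x y z hx hy hz hxyz
    exact ⟨f.comp e.toMonoidHom, by simp [h1], by simp [h2], by simp [h3]⟩

end

noncomputable section

lemma add_inv_eq_iff {F : Type*} [Field F] {a b : F} (ha : a ≠ 0) (hb : b ≠ 0) :
    a + a⁻¹ = b + b⁻¹ ↔ a = b ∨ a * b = 1 := by
  constructor
  · intro h
    have h1 : (a - b) * (a * b - 1) = 0 := by
      field_simp at h
      linear_combination h
    rcases mul_eq_zero.1 h1 with h | h
    · left; exact sub_eq_zero.1 h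
    · right; exact sub_eq_zero.1 h
  · rintro (h | h)
    · rw [h]
    · rw [eq_inv_of_mul_eq_one_left h, inv_inv, add_comm]

lemma galois_ring_aux (m : ℕ) (hm : 1 ≤ m) (u : ℤ) (hu : IsCoprime u ((2 * m : ℕ) : ℤ))
    (L : Type) [Field L] [Algebra ℚ L] [IsCyclotomicExtension {2 * m} ℚ L] :
    ∃ R : Subring ℝ, ∀ k : ℤ, 2 * Real.cos (k * (Real.pi / m)) ∈ R ↔
      ((2 * m : ℕ) : ℤ) ∣ u * k - k ∨ ((2 * m : ℕ) : ℤ) ∣ u * k + k := by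
  have hN0 : 2 * m ≠ 0 := by omega
  haveI : NeZero (2 * m) := ⟨hN0⟩
  have hm0 : (m:ℝ) ≠ 0 := by exact_mod_cast (by omega : m ≠ 0)
  haveI : FiniteDimensional ℚ L := IsCyclotomicExtension.finiteDimensional {2*m} ℚ L
  let ι : L →ₐ[ℚ] ℂ := IsAlgClosed.lift
  have hιinj : Function.Injective ι := ι.injective
  set ζ : L := IsCyclotomicExtension.zeta (2*m) ℚ L with hζdef
  have hζ : IsPrimitiveRoot ζ (2*m) := IsCyclotomicExtension.zeta_spec (2*m) ℚ L
  have hε := Complex.isPrimitiveRoot_exp (2*m) hN0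
  set ε := Complex.exp (2 * Real.pi * Complex.I / ((2*m : ℕ) : ℂ)) with hεdef
  obtain ⟨j, -, hj⟩ := (hζ.map_of_injective hιinj).eq_pow_of_pow_eq_one hε.pow_eq_one
  have hz : ι (ζ^j) = ε := by rw [map_pow, hj]
  have hzp : IsPrimitiveRoot (ζ^j) (2*m) := by
    rw [← hz] at hε
    exact hε.of_map_of_injective hιinj
  obtain ⟨u', hu'⟩ : ∃ u' : ℕ, (u':ℤ) = u % (2*m : ℕ) := ⟨(u % (2*m : ℕ)).toNat, by
    rw [Int.toNat_of_nonneg (Int.emod_nonneg _ (by omega))]⟩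
  have huu : ((2*m : ℕ) : ℤ) ∣ u - u' := by rw [hu']; exact Int.dvd_self_sub_emod
  have hcop : Nat.Coprime u' (2*m) := by
    rw [← Nat.isCoprime_iff_coprime]
    obtain ⟨c, hc⟩ := huu
    have : (u':ℤ) = u + ((2*m : ℕ) : ℤ) * (-c) := by linarith
    rw [this]
    exact hu.add_mul_left_left _
  have hζu : IsPrimitiveRoot (ζ^u') (2*m) := hζ.pow_of_coprime u' hcop
  have hirr := Polynomial.cyclotomic.irreducible_rat (n := 2*m) (by omega)
  let τ : L ≃ₐ[ℚ] L := IsCyclotomicExtension.fromZetaAut hζu hirr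
  have hτ : τ ζ = ζ^u' := IsCyclotomicExtension.fromZetaAut_spec hζu hirr
  set z := ζ^j with hzdef
  have hτz : τ z = z^u' := by rw [hzdef, map_pow, hτ, ← pow_mul, ← pow_mul, mul_comm u' j]
  have hz0 : z ≠ 0 := hzp.ne_zero hN0
  let R : Subring ℝ := (((RingHom.eqLocus (τ : L →+* L) (RingHom.id L))).map (ι : L →+* ℂ)).comap Complex.ofRealHom
  have hR : ∀ x : ℝ, x ∈ R ↔ ∃ y : L, τ y = y ∧ ι y = (x:ℂ) := fun x => Iff.rfl
  refine ⟨R, fun k => ?_⟩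
  have hcos : ι (z^k + (z^k)⁻¹) = ((2 * Real.cos (k * (Real.pi / m)) : ℝ) : ℂ) := by
    rw [map_add, map_inv₀, map_zpow₀, hz, hεdef, ← Complex.exp_int_mul, ← Complex.exp_neg]
    push_cast
    rw [Complex.two_cos]
    congr 2 <;> · push_cast; field_simp
  have hmem : 2 * Real.cos (k * (Real.pi / m)) ∈ R ↔ τ (z^k + (z^k)⁻¹) = z^k + (z^k)⁻¹ := by
    rw [hR]
    constructor
    · rintro ⟨y, h1, h2⟩
      rw [← hcos] at h2
      rw [← hιinj h2, h1]
    · intro h; exact ⟨_, h, hcos⟩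
  have hzk : z^k ≠ 0 := zpow_ne_zero _ hz0
  have e1 : (z^u')^k = z^((u':ℤ)*k) := by rw [zpow_mul, zpow_natCast]
  rw [hmem, map_add, map_inv₀, map_zpow₀, hτz, e1, add_inv_eq_iff (zpow_ne_zero _ hz0) hzk,
    ← zpow_add₀ hz0, hzp.zpow_eq_one_iff_dvd]
  have e2 : z ^ ((u':ℤ)*k) = z^k ↔ ((2*m : ℕ) : ℤ) ∣ u'*k - k := by
    rw [← hzp.zpow_eq_one_iff_dvd, zpow_sub₀ hz0, div_eq_one_iff_eq hzk]
  rw [e2]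
  have d1 : ((2*m : ℕ) : ℤ) ∣ (u - u') * k := huu.mul_right k
  apply or_congr
  · rw [show u * k - k = (u'*k - k) + (u-u')*k by ring]
    exact (dvd_add_left d1).symm
  · rw [show u * k + k = (u'*k + k) + (u-u')*k by ring]
    exact (dvd_add_left d1).symm

lemma galois_ring (m : ℕ) (hm : 1 ≤ m) (u : ℤ) (hu : IsCoprime u ((2 * m : ℕ) : ℤ)) :
    ∃ R : Subring ℝ, ∀ k : ℤ, 2 * Real.cos (k * (Real.pi / m)) ∈ R ↔
      ((2 * m : ℕ) : ℤ) ∣ u * k - k ∨ ((2 * m : ℕ) : ℤ) ∣ u * k + k := by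
  haveI : NeZero (2 * m) := ⟨by omega⟩
  haveI : NeZero ((2 * m : ℕ) : ℚ) := ⟨by exact_mod_cast (by omega : 2 * m ≠ 0)⟩
  exact @galois_ring_aux m hm u hu (CyclotomicField (2 * m) ℚ) _ (CyclotomicField.algebra (2*m) ℚ)
    (CyclotomicField.isCyclotomicExtension (2 * m) ℚ)

lemma unit_lift {N R m : ℕ} (hm : 1 ≤ m) (hc : Nat.Coprime N R) (hd : N * R ∣ m) :
    ∃ u : ℤ, IsCoprime u ((2 * m : ℕ) : ℤ) ∧ (2 * N : ℤ) ∣ u - 1 ∧ (2 * R : ℤ) ∣ u + 1 := by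
  obtain ⟨s, t, hst⟩ := Nat.isCoprime_iff_coprime.2 hc
  have hne : 2 * m ≠ 0 := by omega
  haveI : NeZero (2 * m) := ⟨hne⟩
  have hdvd : 2 * (N * R) ∣ 2 * m := Nat.mul_dvd_mul_left 2 hd
  set u0 : ℤ := 1 - 2 * s * N with hu0
  have h1 : u0 - 1 = 2 * N * (-s) := by rw [hu0]; ring
  have h2 : u0 + 1 = 2 * R * t := by rw [hu0]; linear_combination -2 * hst
  have hcop : IsCoprime u0 ((2 * (N * R) : ℕ) : ℤ) := by
    have c1 : IsCoprime u0 (2 * N : ℤ) := ⟨1, s, by rw [hu0]; ring⟩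
    have c2 : IsCoprime u0 (R : ℤ) := ⟨-1, 2 * t, by linear_combination -h2⟩
    have := c1.mul_right c2
    push_cast; rwa [← mul_assoc]
  have hu : IsUnit ((u0 : ℤ) : ZMod (2 * (N*R))) := by
    rw [ZMod.coe_int_isUnit_iff_isCoprime]; exact hcop.symm
  obtain ⟨w, hw⟩ := ZMod.unitsMap_surjective hdvd hu.unit
  refine ⟨((w : ZMod (2*m)).val : ℤ), ?_, ?_⟩
  · exact Nat.isCoprime_iff_coprime.2 (ZMod.val_coe_unit_coprime w)
  · have hw2 : (((w : ZMod (2*m)).val : ℤ) : ZMod (2*(N*R))) = ((u0 : ℤ) : ZMod (2 * (N*R))) := by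
      have := congrArg Units.val hw
      rw [ZMod.unitsMap_val] at this
      rw [IsUnit.unit_spec] at this
      rw [← this, Int.cast_natCast, ZMod.natCast_val]
    rw [ZMod.intCast_eq_intCast_iff_dvd_sub] at hw2
    obtain ⟨c, hc⟩ := hw2
    push_cast at hc
    constructor
    · exact ⟨-s - R * c, by linear_combination h1 - hc⟩
    · exact ⟨t - N * c, by linear_combination h2 - hc⟩

namespace HPt

/-- Traces of all words lie in the ring generated by the basic traces. -/
lemma trace_mem {X Y : SL2R} {R : Subring ℝ} (hx : X 0 0 + X 1 1 ∈ R) (hy : Y 0 0 + Y 1 1 ∈ R)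
    (ht : (X * Y) 0 0 + (X * Y) 1 1 ∈ R) {M : SL2R} (hM : M ∈ Subgroup.closure {X, Y}) :
    M 0 0 + M 1 1 ∈ R := by
  obtain ⟨x, hx'⟩ : ∃ x, x = X 0 0 + X 1 1 := ⟨_, rfl⟩
  obtain ⟨y, hy'⟩ : ∃ y, y = Y 0 0 + Y 1 1 := ⟨_, rfl⟩
  obtain ⟨t, ht'⟩ : ∃ t, t = (X * Y) 0 0 + (X * Y) 1 1 := ⟨_, rfl⟩
  rw [← hx'] at hx
  rw [← hy'] at hy
  rw [← ht'] at ht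
  let S : SL2R → Prop := fun M => ∃ c0 ∈ R, ∃ c1 ∈ R, ∃ c2 ∈ R, ∃ c3 ∈ R,
    (M : Matrix (Fin 2) (Fin 2) ℝ) = c0 • 1 + c1 • (X : Matrix (Fin 2) (Fin 2) ℝ)
      + c2 • (Y : Matrix (Fin 2) (Fin 2) ℝ) + c3 • ((X : Matrix (Fin 2) (Fin 2) ℝ) * Y)
  have hXX := sq_formula X
  have hYY := sq_formula Y
  rw [← hx'] at hXX
  rw [← hy'] at hYY
  have dX := det_eq X
  have dY := det_eq Y
  have hXi : ((X⁻¹ : SL2R) : Matrix (Fin 2) (Fin 2) ℝ) = x • 1 - (X : Matrix (Fin 2) (Fin 2) ℝ) := by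
    ext i j
    fin_cases i <;> fin_cases j <;>
      simp [Matrix.SpecialLinearGroup.coe_inv, Matrix.adjugate_fin_two, hx']
  have hYi : ((Y⁻¹ : SL2R) : Matrix (Fin 2) (Fin 2) ℝ) = y • 1 - (Y : Matrix (Fin 2) (Fin 2) ℝ) := by
    ext i j
    fin_cases i <;> fin_cases j <;>
      simp [Matrix.SpecialLinearGroup.coe_inv, Matrix.adjugate_fin_two, hy']
  have hYX : (Y : Matrix (Fin 2) (Fin 2) ℝ) * X = (t - x * y) • 1 +
      y • (X : Matrix (Fin 2) (Fin 2) ℝ) + x • (Y : Matrix (Fin 2) (Fin 2) ℝ)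
      - (X : Matrix (Fin 2) (Fin 2) ℝ) * Y := by
    ext i j
    fin_cases i <;> fin_cases j <;>
      simp [Matrix.mul_apply, Fin.sum_univ_two, hx', hy', ht'] <;> ring
  have hXYX : (X : Matrix (Fin 2) (Fin 2) ℝ) * Y * X =
      t • (X : Matrix (Fin 2) (Fin 2) ℝ) - (y • 1 - Y) := by
    ext i j
    fin_cases i <;> fin_cases j <;>
      simp [Matrix.mul_apply, Fin.sum_univ_two, hy', ht']
    · linear_combination (-Y 1 1) * dX
    · linear_combination (Y 0 1) * dX
    · linear_combination (Y 1 0) * dX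
    · linear_combination (-Y 0 0) * dX
  have hXYY : (X : Matrix (Fin 2) (Fin 2) ℝ) * Y * Y =
      y • ((X : Matrix (Fin 2) (Fin 2) ℝ) * Y) - X := by
    rw [mul_assoc, hYY, mul_sub, mul_smul_comm, mul_one]
  have SX : ∀ M, S M → S (M * X) := by
    rintro M ⟨c0, h0, c1, h1, c2, h2, c3, h3, hM⟩
    refine ⟨-c1 + c2 * (t - x*y) - c3 * y, ?_, c0 + c1 * x + c2 * y + c3 * t, ?_,
      c2 * x + c3, ?_, - c2, ?_, ?_⟩
    · exact R.sub_mem (R.add_mem (R.neg_mem h1) (R.mul_mem h2 (R.sub_mem ht (R.mul_mem hx hy))))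
        (R.mul_mem h3 hy)
    · exact R.add_mem (R.add_mem (R.add_mem h0 (R.mul_mem h1 hx)) (R.mul_mem h2 hy)) (R.mul_mem h3 ht)
    · exact R.add_mem (R.mul_mem h2 hx) h3
    · exact R.neg_mem h2
    · rw [Matrix.SpecialLinearGroup.coe_mul, hM, add_mul, add_mul, add_mul, smul_mul_assoc,
        smul_mul_assoc, smul_mul_assoc, smul_mul_assoc, one_mul, hXX, hYX, hXYX]
      module
  have SY : ∀ M, S M → S (M * Y) := by
    rintro M ⟨c0, h0, c1, h1, c2, h2, c3, h3, hM⟩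
    refine ⟨-c2, R.neg_mem h2, -c3, R.neg_mem h3,
      c0 + c2 * y, R.add_mem h0 (R.mul_mem h2 hy), c1 + c3 * y, R.add_mem h1 (R.mul_mem h3 hy), ?_⟩
    rw [Matrix.SpecialLinearGroup.coe_mul, hM, add_mul, add_mul, add_mul, smul_mul_assoc,
        smul_mul_assoc, smul_mul_assoc, smul_mul_assoc, one_mul, hYY, hXYY]
    module
  have Ssub : ∀ M N K : SL2R, ∀ c ∈ R, S M → S N →
      (K : Matrix (Fin 2) (Fin 2) ℝ) = c • (M : Matrix (Fin 2) (Fin 2) ℝ) - N → S K := by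
    rintro M N K c hc ⟨c0, h0, c1, h1, c2, h2, c3, h3, hM⟩ ⟨d0, k0, d1, k1, d2, k2, d3, k3, hN⟩ hK
    refine ⟨c * c0 - d0, R.sub_mem (R.mul_mem hc h0) k0, c * c1 - d1, R.sub_mem (R.mul_mem hc h1) k1,
      c * c2 - d2, R.sub_mem (R.mul_mem hc h2) k2, c * c3 - d3, R.sub_mem (R.mul_mem hc h3) k3, ?_⟩
    rw [hK, hM, hN]; module
  have hS : S M := by
    induction hM using Subgroup.closure_induction_right with
    | one => exact ⟨1, R.one_mem, 0, R.zero_mem, 0, R.zero_mem, 0, R.zero_mem, by simp⟩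
    | mul_right M _ N hN ih =>
      rcases hN with rfl | hN
      · exact SX M ih
      · rw [Set.mem_singleton_iff] at hN; rw [hN]; exact SY M ih
    | mul_inv_cancel M _ N hN ih =>
      rcases hN with rfl | hN
      · refine Ssub M (M * N) _ x hx ih (SX M ih) ?_
        rw [Matrix.SpecialLinearGroup.coe_mul, hXi, mul_sub, mul_smul_comm, mul_one,
          Matrix.SpecialLinearGroup.coe_mul]
      · rw [Set.mem_singleton_iff] at hN; subst hN
        refine Ssub M (M * N) _ y hy ih (SY M ih) ?_
        rw [Matrix.SpecialLinearGroup.coe_mul, hYi, mul_sub, mul_smul_comm, mul_one,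
          Matrix.SpecialLinearGroup.coe_mul]
  obtain ⟨c0, h0, c1, h1, c2, h2, c3, h3, hM⟩ := hS
  have : M 0 0 + M 1 1 = c0 * 2 + c1 * x + c2 * y + c3 * t := by
    rw [hM, hx', hy', ht']; simp; ring
  rw [this]
  have h2R : (2:ℝ) ∈ R := ofNat_mem R 2
  exact R.add_mem (R.add_mem (R.add_mem (R.mul_mem h0 h2R) (R.mul_mem h1 hx)) (R.mul_mem h2 hy))
    (R.mul_mem h3 ht)

end HPt
end

noncomputable section
namespace HPt

variable {Δ : Subgroup PSL2R}

lemma Geo.zpow_coe (G : Geo Δ) (k : ℤ) :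
    ((G.a ^ k : Δ) : PSL2R) = (G.P.rot (k * (Real.pi / G.m)) : SL2R) := by
  rw [rot_int, QuotientGroup.mk_zpow, ← G.ha]; rfl

lemma Geo.order_a (G : Geo Δ) : orderOf G.a = G.m := by
  have hm := G.hm
  have hm0 : (G.m : ℝ) ≠ 0 := by exact_mod_cast (by omega : G.m ≠ 0)
  have key : ∀ k : ℕ, G.a ^ k = 1 ↔ G.m ∣ k := by
    intro k
    have h1 : G.a ^ k = 1 ↔ ((G.a ^ (k:ℤ) : Δ) : PSL2R) = 1 := by
      rw [zpow_natCast]; exact (OneMemClass.coe_eq_one).symm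
    rw [h1, G.zpow_coe, QuotientGroup.eq_one_iff, rot_mem_center, Real.sin_eq_zero_iff]
    constructor
    · rintro ⟨n, hn⟩
      have h2 : (n:ℝ) * G.m = k := by
        field_simp at hn
        push_cast at hn
        exact_mod_cast hn
      have h3 : n * (G.m : ℤ) = k := by exact_mod_cast h2
      exact Int.natCast_dvd_natCast.1 ⟨n, by rw [← h3, mul_comm]⟩
    · rintro ⟨c, rfl⟩
      refine ⟨c, ?_⟩
      push_cast
      field_simp
  apply Nat.dvd_antisymm
  · exact orderOf_dvd_of_pow_eq_one ((key _).2 dvd_rfl)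
  · exact (key _).1 (pow_orderOf_eq_one _)

lemma cyc {D : Type*} [Group D] {a : D} {m : ℕ} (hm : 0 < m) (ha : orderOf a = m) (i : ℤ) :
    ∃ (d : ℕ) (j s : ℤ), i = d * j ∧ m = orderOf (a ^ i) * d ∧ a ^ d = (a ^ i) ^ s := by
  obtain ⟨d, hd⟩ : ∃ d, d = Int.gcd m i := ⟨_, rfl⟩
  have h1 : (d:ℤ) ∣ m := by rw [hd]; exact Int.gcd_dvd_left _ _
  have h1' : d ∣ m := by exact_mod_cast h1
  have h2 : (d:ℤ) ∣ i := by rw [hd]; exact Int.gcd_dvd_right _ _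
  obtain ⟨j, hj⟩ := h2
  have hb := Int.gcd_eq_gcd_ab m i
  rw [← hd] at hb
  have h3 : a ^ d = (a ^ i) ^ (Int.gcdB m i) := by
    rw [← zpow_natCast, hb, zpow_add, zpow_mul, zpow_natCast, ← ha, pow_orderOf_eq_one, one_zpow,
      one_mul, zpow_mul, ha]
  have h4 : a ^ i = (a ^ d) ^ j := by rw [hj, zpow_mul, zpow_natCast]
  have h5 : orderOf (a ^ i) = orderOf (a ^ d) := by
    apply Nat.dvd_antisymm
    · rw [h4, orderOf_dvd_iff_pow_eq_one, ← zpow_natCast, ← zpow_mul, mul_comm, zpow_mul,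
        zpow_natCast, pow_orderOf_eq_one, one_zpow]
    · rw [h3, orderOf_dvd_iff_pow_eq_one, ← zpow_natCast, ← zpow_mul, mul_comm, zpow_mul,
        zpow_natCast, pow_orderOf_eq_one, one_zpow]
  have hd0 : d ≠ 0 := by rintro rfl; rw [zero_dvd_iff] at h1'; omega
  refine ⟨d, j, _, hj, ?_, h3⟩
  rw [h5, orderOf_pow_of_dvd hd0 (by rw [ha]; exact h1'), ha, Nat.div_mul_cancel h1']

lemma Geo.big (G : Geo Δ) {x : Δ} {e : ℕ} (hx : orderOf x = e) (he : 4 ≤ e) :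
    ∃ (h : Δ) (d : ℕ) (j s : ℤ), x = h * G.a ^ (d * j) * h⁻¹ ∧ G.m = e * d ∧
      G.a ^ d = (G.a ^ (d * j)) ^ s := by
  have hm := G.hm
  obtain ⟨h, i, hi⟩ := G.htors x (by omega)
  obtain ⟨d, j, s, h1, h2, h3⟩ := cyc (by omega) G.order_a i
  have : orderOf (G.a ^ i) = e := by
    rw [← hx, hi]
    exact ((MulAut.conj h).orderOf_eq (G.a ^ i)).symm
  rw [this] at h2
  rw [h1] at hi h3
  exact ⟨h, d, j, s, hi, h2, h3⟩

lemma Geo.dvd_m (G : Geo Δ) {x : Δ} {e : ℕ} (hx : orderOf x = e) (he : 4 ≤ e) : e ∣ G.m := by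
  obtain ⟨h, d, j, s, -, h2, -⟩ := G.big hx he
  exact ⟨d, h2⟩

lemma Geo.hom_triv (G : Geo Δ) {C : Type*} [CommGroup C] (φ : Δ →* C) (h : φ G.a = 1) (x : Δ) :
    φ x = 1 := by
  have hb : φ G.b = 1 := by rw [G.hconj, map_mul, map_mul, h, mul_one, ← map_mul, mul_inv_cancel, map_one]
  have : Subgroup.closure {G.a, G.b} ≤ φ.ker := by
    rw [Subgroup.closure_le]
    rintro y (rfl | hy)
    · exact h
    · rw [Set.mem_singleton_iff] at hy; rw [hy]; exact hb
  rw [G.hgen] at this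
  exact this (Subgroup.mem_top x)

lemma Geo.hom_six (G : Geo Δ) {C : Type*} [CommGroup C] (φ : Δ →* C) : φ G.a ^ 6 = 1 := by
  have hb : φ G.b = φ G.a := by
    rw [G.hconj, map_mul, map_mul, mul_comm (φ G.g), mul_assoc, ← map_mul, mul_inv_cancel, map_one,
      mul_one]
  have := congrArg φ G.hcube
  rw [map_pow, map_mul, hb, map_one, ← pow_two, ← pow_mul] at this
  exact this

/-- Two large exponents share no prime. -/
lemma Geo.coprime (G : Geo Δ) {p q r : ℕ} {X Y Z : Δ} (T : IsTri p q r X Y Z)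
    (hp : 2 ≤ p) (hq : 4 ≤ q) (hr : 4 ≤ r) : Nat.Coprime q r := by
  by_contra hc
  obtain ⟨l, hl, hlq, hlr⟩ := Nat.Prime.not_coprime_iff_dvd.1 hc
  obtain ⟨o1, o2, o3⟩ := T.orders hp (by omega) (by omega)
  have hl6 : l ∣ 6 := by
    obtain ⟨φ, f1, f2, f3⟩ := T.univ (Multiplicative (ZMod l)) 1 (Multiplicative.ofAdd 1)
      (Multiplicative.ofAdd (-1)) (one_pow _)
      (by
        rw [← ofAdd_nsmul, nsmul_eq_mul, (ZMod.natCast_eq_zero_iff q l).2 hlq, zero_mul]; rfl)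
      (by
        rw [← ofAdd_nsmul, nsmul_eq_mul, (ZMod.natCast_eq_zero_iff r l).2 hlr, zero_mul]; rfl)
      (by rw [one_mul, ← ofAdd_add, add_neg_cancel]; rfl)
    have h6 := G.hom_six φ
    have hne : φ G.a ≠ 1 := by
      intro h
      have := G.hom_triv φ h Y
      rw [f2] at this
      have h1 : (1 : ZMod l) = 0 := this
      have : Fact (1 < l) := ⟨hl.one_lt⟩
      exact one_ne_zero h1
    have ho : orderOf (φ G.a) ∣ l := by
      apply orderOf_dvd_of_pow_eq_one
      apply Multiplicative.toAdd.injective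
      rw [toAdd_pow, nsmul_eq_mul, ZMod.natCast_self, zero_mul, toAdd_one]
    rcases (Nat.dvd_prime hl).1 ho with h | h
    · exact absurd (orderOf_eq_one_iff.1 h) hne
    · rw [← h]; exact orderOf_dvd_of_pow_eq_one h6
  have hl3 : l ≤ 3 := by
    have := Nat.le_of_dvd (by norm_num) hl6
    interval_cases l <;> first | omega | (revert hl; decide)
  obtain ⟨σ, -, s2, s3, -⟩ := T.rep (α := 1) (β := l) (γ := 1) one_pos (by omega) hl.pos (by omega)
    one_pos (by omega)
  obtain ⟨h, d, j, s, e1, e2, e3⟩ := G.big o2 hq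
  obtain ⟨h', d', j', s', e1', e2', e3'⟩ := G.big o3 hr
  obtain ⟨k, hk⟩ := hlq
  obtain ⟨k', hk'⟩ := hlr
  have y1 : σ Y ^ k = 1 := (s2 k).2 (by rw [hk])
  have y2 : σ (G.a ^ (d * j)) ^ k = 1 := by
    have : G.a ^ (d * j) = h⁻¹ * Y * h := by rw [e1]; group
    rw [← map_pow, this]
    have : (h⁻¹ * Y * h) ^ k = h⁻¹ * Y ^ k * h := by
      have := conj_pow (i := k) (a := h⁻¹) (b := Y)
      rwa [inv_inv] at this
    rw [this, map_mul, map_mul, map_pow, y1, mul_one, ← map_mul, inv_mul_cancel, map_one]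
  have y3 : σ G.a ^ (d * k) = 1 := by
    rw [pow_mul, ← map_pow, e3, map_zpow, ← zpow_natCast, ← zpow_mul, mul_comm s, zpow_mul,
      zpow_natCast, y2, one_zpow]
  have hdk : d * k = d' * k' := by
    apply Nat.eq_of_mul_eq_mul_left hl.pos
    rw [e2, hk, hk'] at e2'
    linarith
  have z1 : σ Z ^ k' = 1 := by
    rw [e1', ← map_pow, conj_pow, map_mul, map_mul]
    have : σ ((G.a ^ ((d':ℤ) * j')) ^ k') = 1 := by
      rw [map_pow, map_zpow, ← zpow_natCast, ← zpow_mul, mul_assoc, mul_comm j', ← mul_assoc,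
        zpow_mul]
      have : σ G.a ^ ((d':ℤ) * k') = 1 := by rw [hdk] at y3; exact_mod_cast y3
      rw [this, one_zpow]
    rw [this, mul_one, ← map_mul, mul_inv_cancel, map_one]
  have := (s3 k').1 z1
  rw [one_mul] at this
  have hk0 : 0 < k' := by
    rcases Nat.eq_zero_or_pos k' with h | h
    · rw [h] at hk'; omega
    · exact h
  have h2 := Nat.le_of_dvd hk0 this
  have h3 := hl.two_le
  nlinarith

/-- Admissible exponents for the Galois argument. -/
def Good (u : ℤ) (e : ℕ) : Prop :=
  e = 2 ∨ e = 3 ∨ (4 ≤ e ∧ ((2 * e : ℤ) ∣ u - 1 ∨ (2 * e : ℤ) ∣ u + 1))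

lemma neg_tr (M : SL2R) : (-M) 0 0 + (-M) 1 1 = -(M 0 0 + M 1 1) := by
  simp; ring

lemma tr_rot (P : HPt) (θ : ℝ) : P.rot θ 0 0 + P.rot θ 1 1 = 2 * Real.cos θ := by
  rw [rot_00, rot_11]; ring

lemma Geo.gen_trace (G : Geo Δ) {u : ℤ} {R : Subring ℝ}
    (hR : ∀ k : ℤ, 2 * Real.cos (k * (Real.pi / G.m)) ∈ R ↔
      ((2 * G.m : ℕ) : ℤ) ∣ u * k - k ∨ ((2 * G.m : ℕ) : ℤ) ∣ u * k + k)
    {x : Δ} {e : ℕ} (hx : orderOf x = e) (he : Good u e) {M : SL2R} (hM : (M : PSL2R) = x) :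
    M 0 0 + M 1 1 ∈ R := by
  have hpow : (M : PSL2R) ^ e = 1 := by
    rw [hM, ← hx]
    exact_mod_cast congrArg Subtype.val (pow_orderOf_eq_one x)
  have hne : 2 ≤ e → (M : PSL2R) ≠ 1 := by
    intro h2 h
    rw [hM] at h
    have h1 : x = 1 := by exact_mod_cast h
    rw [h1, orderOf_one] at hx
    omega
  rcases he with rfl | rfl | ⟨h4, hd⟩
  · rw [tr_order_two hpow (hne le_rfl)]; exact R.zero_mem
  · rcases tr_order_three hpow (hne (by omega)) with h | h <;> rw [h]
    · exact R.one_mem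
    · exact R.neg_mem R.one_mem
  · obtain ⟨h, d, j, s, e1, e2, e3⟩ := G.big hx h4
    obtain ⟨g, hg⟩ := QuotientGroup.mk_surjective (h : PSL2R)
    have hMM : (M : PSL2R) = ((g * G.P.rot (((d * j : ℤ) : ℝ) * (Real.pi / G.m)) * g⁻¹ : SL2R) : PSL2R) := by
      rw [hM, e1, QuotientGroup.mk_mul, QuotientGroup.mk_mul, QuotientGroup.mk_inv, hg, ← G.zpow_coe]
      rfl
    have hmem : 2 * Real.cos (((d * j : ℤ) : ℝ) * (Real.pi / G.m)) ∈ R := by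
      rw [hR, e2]
      push_cast
      rcases hd with ⟨c, hc⟩ | ⟨c, hc⟩
      · left; exact ⟨c * j, by linear_combination (d * j : ℤ) * hc⟩
      · right; exact ⟨c * j, by linear_combination (d * j : ℤ) * hc⟩
    rw [conj_rot, mk_eq] at hMM
    rcases hMM with h | h
    · rw [h, tr_rot]; exact hmem
    · rw [h, neg_tr, tr_rot]; exact R.neg_mem hmem

lemma Geo.core (G : Geo Δ) {p q r : ℕ} {X Y Z : Δ} (T : IsTri p q r X Y Z)
    (hp : 2 ≤ p) (hq : 2 ≤ q) (hr : 2 ≤ r) {u : ℤ} (hu : IsCoprime u ((2 * G.m : ℕ) : ℤ))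
    (gp : Good u p) (gq : Good u q) (gr : Good u r) :
    ((2 * G.m : ℕ) : ℤ) ∣ u - 1 ∨ ((2 * G.m : ℕ) : ℤ) ∣ u + 1 := by
  have hm := G.hm
  obtain ⟨R, hR⟩ := galois_ring G.m (by omega) u hu
  obtain ⟨o1, o2, o3⟩ := T.orders hp hq hr
  obtain ⟨A, hA⟩ := QuotientGroup.mk_surjective (X : PSL2R)
  obtain ⟨B, hB⟩ := QuotientGroup.mk_surjective (Y : PSL2R)
  have tA := G.gen_trace hR o1 gp hA
  have tB := G.gen_trace hR o2 gq hB
  have hXY : X * Y = Z⁻¹ := eq_inv_of_mul_eq_one_left T.hXYZ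
  have tAB := G.gen_trace (x := X * Y) (M := A * B) hR (by rw [hXY, orderOf_inv, o3]) gr
    (by rw [QuotientGroup.mk_mul, hA, hB]; rfl)
  have hmem : ∀ x : Δ, x ∈ Subgroup.closure {X, Y} →
      ∃ M ∈ Subgroup.closure {A, B}, (M : PSL2R) = x := by
    intro x hx
    induction hx using Subgroup.closure_induction with
    | mem x hx =>
      rcases hx with rfl | hx
      · exact ⟨A, Subgroup.subset_closure (by simp), hA⟩
      · rw [Set.mem_singleton_iff] at hx; rw [hx]
        exact ⟨B, Subgroup.subset_closure (by simp), hB⟩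
    | one => exact ⟨1, Subgroup.one_mem _, rfl⟩
    | mul x y _ _ hx hy =>
      obtain ⟨M, m1, m2⟩ := hx
      obtain ⟨N, n1, n2⟩ := hy
      exact ⟨M * N, Subgroup.mul_mem _ m1 n1, by rw [QuotientGroup.mk_mul, m2, n2]; rfl⟩
    | inv x _ hx =>
      obtain ⟨M, m1, m2⟩ := hx
      exact ⟨M⁻¹, Subgroup.inv_mem _ m1, by rw [QuotientGroup.mk_inv, m2]; rfl⟩
  obtain ⟨M, m1, m2⟩ := hmem G.a (by rw [T.gen2]; trivial)
  have tM := trace_mem tA tB tAB m1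
  have hc : 2 * Real.cos (Real.pi / G.m) ∈ R := by
    rw [G.ha, mk_eq] at m2
    rcases m2 with h | h
    · rw [h, tr_rot] at tM; exact tM
    · rw [h, neg_tr, tr_rot] at tM
      have := R.neg_mem tM
      rwa [neg_neg] at this
  have := (hR 1).1 (by simpa using hc)
  simpa using this

lemma Geo.coprimePair (G : Geo Δ) {p q r : ℕ} {X Y Z : Δ} (T : IsTri p q r X Y Z)
    (hp : 2 ≤ p) (hq : 2 ≤ q) (hr : 2 ≤ r) {N R : ℕ} (hN : 2 ≤ N) (hR : 2 ≤ R)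
    (hc : Nat.Coprime N R) (hNm : N ∣ G.m) (hRm : R ∣ G.m)
    (gp : p = 2 ∨ p = 3 ∨ (4 ≤ p ∧ (p ∣ N ∨ p ∣ R)))
    (gq : q = 2 ∨ q = 3 ∨ (4 ≤ q ∧ (q ∣ N ∨ q ∣ R)))
    (gr : r = 2 ∨ r = 3 ∨ (4 ≤ r ∧ (r ∣ N ∨ r ∣ R))) : False := by
  have hm := G.hm
  obtain ⟨u, hu, u1, u2⟩ := unit_lift (N := N) (R := R) (m := G.m) (by omega) hc
    (Nat.Coprime.mul_dvd_of_dvd_of_dvd hc hNm hRm)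
  have good : ∀ e : ℕ, (e = 2 ∨ e = 3 ∨ (4 ≤ e ∧ (e ∣ N ∨ e ∣ R))) → Good u e := by
    rintro e (h | h | ⟨h, h' | h'⟩)
    · exact Or.inl h
    · exact Or.inr (Or.inl h)
    · exact Or.inr (Or.inr ⟨h, Or.inl ((mul_dvd_mul_left 2 (Int.natCast_dvd_natCast.2 h')).trans u1)⟩)
    · exact Or.inr (Or.inr ⟨h, Or.inr ((mul_dvd_mul_left 2 (Int.natCast_dvd_natCast.2 h')).trans u2)⟩)
  have fin : ∀ K : ℕ, 2 ≤ K → (2 * K : ℤ) ∣ u - 1 → (2 * K : ℤ) ∣ u + 1 → False := by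
    intro K hK h1 h2
    have h3 := dvd_sub h2 h1
    have h4 : u + 1 - (u - 1) = 2 := by ring
    rw [h4] at h3
    have := Int.le_of_dvd (by norm_num) h3
    omega
  have tr : ∀ K : ℕ, K ∣ G.m → (2 * K : ℤ) ∣ ((2 * G.m : ℕ) : ℤ) := by
    intro K hK
    push_cast
    exact mul_dvd_mul_left 2 (Int.natCast_dvd_natCast.2 hK)
  rcases G.core T hp hq hr hu (good _ gp) (good _ gq) (good _ gr) with h | h
  · exact fin R hR ((tr R hRm).trans h) u2
  · exact fin N hN u1 ((tr N hNm).trans h)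

/-- The `(3,3,r)` case is impossible. -/
lemma Geo.three_three (G : Geo Δ) {r : ℕ} {X Y Z : Δ} (T : IsTri 3 3 r X Y Z) (hr : 4 ≤ r) :
    False := by
  have hm := G.hm
  obtain ⟨o1, o2, o3⟩ := T.orders (by norm_num) (by norm_num) (by omega)
  have hrm := G.dvd_m o3 hr
  have c3 : ∀ x : Multiplicative (ZMod 3), x ^ 3 = 1 := by decide
  obtain ⟨φ, f1, f2, f3⟩ := T.univ (Multiplicative (ZMod 3)) (Multiplicative.ofAdd 1)
      (Multiplicative.ofAdd (-1)) 1 (c3 _) (c3 _) (one_pow _) (by decide)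
  have hφ : φ G.a ≠ 1 := by
    intro h
    have := G.hom_triv φ h X
    rw [f1] at this
    revert this; decide
  by_cases h3 : 3 ∣ r
  · obtain ⟨ψ, g1, g2, g3⟩ := T.univ (Multiplicative (ZMod 3)) (Multiplicative.ofAdd 1) 1
      (Multiplicative.ofAdd (-1)) (c3 _) (c3 _)
      (by obtain ⟨c, hc⟩ := h3; rw [hc, pow_mul, c3, one_pow]) (by decide)
    have k1 : ψ G.a ≠ 1 := by
      intro h
      have := G.hom_triv ψ h X
      rw [g1] at this
      revert this; decide
    have k2 : (φ * ψ) G.a ≠ 1 := by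
      intro h
      have := G.hom_triv (φ * ψ) h X
      rw [MonoidHom.mul_apply, f1, g1] at this
      revert this; decide
    have k3 : (φ * ψ⁻¹) G.a ≠ 1 := by
      intro h
      have := G.hom_triv (φ * ψ⁻¹) h Y
      rw [MonoidHom.mul_apply, MonoidHom.inv_apply, f2, g2] at this
      revert this; decide
    rw [MonoidHom.mul_apply] at k2 k3
    rw [MonoidHom.inv_apply] at k3
    have : ∀ x y : Multiplicative (ZMod 3), x ≠ 1 → y ≠ 1 → x * y ≠ 1 → x * y⁻¹ ≠ 1 → False := by
      decide
    exact this _ _ hφ k1 k2 k3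
  · have h3m : 3 ∣ G.m := by
      have e1 : orderOf (φ G.a) = 3 := orderOf_eq_prime (c3 _) hφ
      rw [← e1, ← G.order_a]
      exact orderOf_map_dvd φ G.a
    exact G.coprimePair T (by norm_num) (by norm_num) (by omega) (N := r) (R := 3) (by omega)
      (by norm_num) ((Nat.Prime.coprime_iff_not_dvd Nat.prime_three).2 h3).symm hrm h3m
      (by simp) (by simp) (Or.inr (Or.inr ⟨hr, Or.inl dvd_rfl⟩))

/-- Case analysis for sorted exponents. -/
lemma Geo.sorted (G : Geo Δ) {p q r : ℕ} {X Y Z : Δ} (T : IsTri p q r X Y Z)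
    (hp : 2 ≤ p) (hpq : p ≤ q) (hqr : q ≤ r) (hhyp : (1 : ℚ) / p + 1 / q + 1 / r < 1) :
    p = 2 ∧ q = 3 ∧ 7 ≤ r := by
  obtain ⟨o1, o2, o3⟩ := T.orders hp (by omega) (by omega)
  by_cases hq4 : 4 ≤ q
  · exfalso
    have hr4 : 4 ≤ r := by omega
    have c1 := G.coprime T hp hq4 hr4
    have m2 := G.dvd_m o2 hq4
    have m3 := G.dvd_m o3 hr4
    by_cases hp4 : 4 ≤ p
    · have m1 := G.dvd_m o1 hp4
      have c2 := G.coprime T.rotate (by omega) hr4 hp4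
      have c3 := G.coprime T.rotate.rotate (by omega) hp4 hq4
      exact G.coprimePair T hp (by omega) (by omega) (N := p * q) (R := r) (by nlinarith) (by omega)
        (Nat.Coprime.mul_left c2.symm c1) (Nat.Coprime.mul_dvd_of_dvd_of_dvd c3 m1 m2) m3
        (Or.inr (Or.inr ⟨hp4, Or.inl (Dvd.intro _ rfl)⟩))
        (Or.inr (Or.inr ⟨hq4, Or.inl (Dvd.intro_left _ rfl)⟩))
        (Or.inr (Or.inr ⟨hr4, Or.inr dvd_rfl⟩))
    · exact G.coprimePair T hp (by omega) (by omega) (N := q) (R := r) (by omega) (by omega)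
        c1 m2 m3 (by omega)
        (Or.inr (Or.inr ⟨hq4, Or.inl dvd_rfl⟩))
        (Or.inr (Or.inr ⟨hr4, Or.inr dvd_rfl⟩))
  · have hrpos : (0:ℚ) < 1 / r := by
      have : (0:ℚ) < r := by exact_mod_cast (by omega : 0 < r)
      positivity
    have hq' : q = 2 ∨ q = 3 := by omega
    rcases hq' with rfl | rfl
    · have : p = 2 := by omega
      subst this
      norm_num at hhyp hrpos
      linarith
    · have : p = 2 ∨ p = 3 := by omega
      rcases this with rfl | rfl
      · refine ⟨rfl, rfl, ?_⟩
        by_contra h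
        have : r ≤ 6 := by omega
        interval_cases r <;> norm_num at hhyp
      · exfalso
        by_cases h4 : 4 ≤ r
        · exact G.three_three T h4
        · have : r = 3 := by omega
          subst this
          norm_num at hhyp

lemma Geo.final (G : Geo Δ) {p q r : ℕ} {X Y Z : Δ} (T : IsTri p q r X Y Z)
    (hp : 2 ≤ p) (hq : 2 ≤ q) (hr : 2 ≤ r) (hhyp : (1 : ℚ) / p + 1 / q + 1 / r < 1) :
    ∃ r' : ℕ, 7 ≤ r' ∧ ({p, q, r} : Multiset ℕ) = ({2, 3, r'} : Multiset ℕ) := by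
  rcases le_total p q with h1 | h1 <;> rcases le_total q r with h2 | h2 <;>
    rcases le_total p r with h3 | h3
  · obtain ⟨rfl, rfl, h⟩ := G.sorted T hp h1 h2 hhyp
    exact ⟨r, h, rfl⟩
  · obtain ⟨rfl, rfl, h⟩ := G.sorted T hp h1 h2 hhyp
    exact ⟨r, h, rfl⟩
  · obtain ⟨rfl, rfl, h⟩ := G.sorted T.reverse.rotate.rotate hp h3 h2 (by linarith)
    exact ⟨q, h, by rw [Multiset.insert_eq_cons, Multiset.insert_eq_cons, Multiset.pair_comm]; rfl⟩
  · obtain ⟨rfl, rfl, h⟩ := G.sorted T.rotate.rotate hr h3 h1 (by linarith)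
    refine ⟨q, h, ?_⟩
    ext x; simp only [Multiset.insert_eq_cons, Multiset.count_cons, Multiset.count_singleton]; ring
  · obtain ⟨rfl, rfl, h⟩ := G.sorted T.reverse.rotate hq h1 h3 (by linarith)
    refine ⟨r, h, ?_⟩
    ext x; simp only [Multiset.insert_eq_cons, Multiset.count_cons, Multiset.count_singleton]; ring
  · obtain ⟨rfl, rfl, h⟩ := G.sorted T.rotate hq h2 h3 (by linarith)
    refine ⟨p, h, ?_⟩
    ext x; simp only [Multiset.insert_eq_cons, Multiset.count_cons, Multiset.count_singleton]; ring
  · obtain ⟨rfl, rfl, h⟩ := G.sorted T.reverse hr h2 h1 (by linarith)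
    refine ⟨p, h, ?_⟩
    ext x; simp only [Multiset.insert_eq_cons, Multiset.count_cons, Multiset.count_singleton]; ring
  · obtain ⟨rfl, rfl, h⟩ := G.sorted T.reverse hr h2 h1 (by linarith)
    refine ⟨p, h, ?_⟩
    ext x; simp only [Multiset.insert_eq_cons, Multiset.count_cons, Multiset.count_singleton]; ring

end HPt
end

/-- If the group of the `n`-twist knot surjects onto a discrete subgroup
`Δ ≤ PSL(2,ℝ)` isomorphic to a hyperbolic triangle group `Δ(p,q,r)` with the image of the
generator `a` elliptic, then `n = 1` (the trefoil) and `(p,q,r)` is a permutation of `(2,3,r')`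
for some `r' ≥ 7`. -/
theorem stmt9 (n : ℤ) (p q r : ℕ) (hp : 2 ≤ p) (hq : 2 ≤ q) (hr : 2 ≤ r)
    (hhyp : (1 : ℚ) / p + 1 / q + 1 / r < 1)
    (Δ : Subgroup PSL2R) (hdisc : DiscreteTopology ↥Δ)
    (hiso : Nonempty (↥Δ ≃* TriangleGroup p q r))
    (ρ : TwistKnotGroup n →* ↥Δ) (hsurj : Function.Surjective ρ)
    (hell : IsElliptic ((ρ (PresentedGroup.of 0) : PSL2R))) :
    n = 1 ∧ ∃ r' : ℕ, 7 ≤ r' ∧ ({p, q, r} : Multiset ℕ) = ({2, 3, r'} : Multiset ℕ) := by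
  obtain ⟨e⟩ := hiso
  have T := isTri_transport e (isTri_presented p q r)
  have hnab : ∃ x y : Δ, x * y ≠ y * x := by
    by_cases hq3 : 3 ≤ q
    · exact T.nonab hp hq3 hr
    by_cases hr3 : 3 ≤ r
    · exact T.rotate.nonab hq hr3 hp
    · have h1 : q = 2 := by omega
      have h2 : r = 2 := by omega
      subst h1 h2
      exfalso
      have h0 : (0:ℚ) < p := by exact_mod_cast (by omega : 0 < p)
      have : (0:ℚ) < 1 / p := by positivity
      push_cast at hhyp
      linarith
  obtain ⟨h1, ⟨G⟩⟩ := HPt.geo n Δ hdisc hnab ρ hsurj hell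
  exact ⟨h1, G.final T hp hq hr hhyp⟩
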